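/- arXiv:1510.07542 — 7 statements merged into one kernel-verified Lean document; each statement's English description precedes it below -/
import Mathlib

section
/- Let p > 0 and let f : ℝ → ℝ be twice continuously differentiable with f(x) > p²x² for all x ∈ ℝ. Suppose there is a constant A > 0 such that for every x̄ ∈ ℝ the tangent line to the curve z = f(x) at (x̄, f(x̄)) cuts off from the parabola z = p²x² a segment of area A, i.e. the 2-dimensional Lebesgue measure of {(x,z) ∈ ℝ² : p²x² ≤ z ≤ f(x̄) + f'(x̄)(x − x̄)} equals A for all x̄. Then f(x) = p²x² + k² for all x, where k = (3pA/4)^{1/3}. -/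
open MeasureTheory

/-- The area of the segment cut off from the parabola `z = p² x²` by the chord whose endpoints have
abscissas `c - h` and `c + h`. -/
theorem volume_parabola_segment (p c h : ℝ) (hh : 0 ≤ h) :
    volume {q : ℝ × ℝ | p ^ 2 * q.1 ^ 2 ≤ q.2 ∧
      q.2 ≤ p ^ 2 * q.1 ^ 2 + p ^ 2 * (h ^ 2 - (q.1 - c) ^ 2)} =
      ENNReal.ofReal (4 / 3 * p ^ 2 * h ^ 3) := by
  have hmeas : MeasurableSet {q : ℝ × ℝ | p ^ 2 * q.1 ^ 2 ≤ q.2 ∧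
      q.2 ≤ p ^ 2 * q.1 ^ 2 + p ^ 2 * (h ^ 2 - (q.1 - c) ^ 2)} := by
    rw [Set.ofPred_and]
    exact (measurableSet_le (by fun_prop) (by fun_prop)).inter
      (measurableSet_le (by fun_prop) (by fun_prop))
  rw [Measure.volume_eq_prod, Measure.prod_apply hmeas]
  have hslice : ∀ x : ℝ, volume (Prod.mk x ⁻¹' {q : ℝ × ℝ | p ^ 2 * q.1 ^ 2 ≤ q.2 ∧
      q.2 ≤ p ^ 2 * q.1 ^ 2 + p ^ 2 * (h ^ 2 - (q.1 - c) ^ 2)}) =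
      (Set.Ioc (c - h) (c + h)).indicator
        (fun x => ENNReal.ofReal (p ^ 2 * (h ^ 2 - (x - c) ^ 2))) x := by
    intro x
    change volume (Set.Icc (p ^ 2 * x ^ 2) (p ^ 2 * x ^ 2 + p ^ 2 * (h ^ 2 - (x - c) ^ 2))) = _
    rw [Real.volume_Icc, add_sub_cancel_left]
    by_cases hx : x ∈ Set.Ioc (c - h) (c + h)
    · rw [Set.indicator_of_mem hx]
    · rw [Set.indicator_of_notMem hx, ENNReal.ofReal_eq_zero]
      refine mul_nonpos_of_nonneg_of_nonpos (sq_nonneg p) ?_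
      rw [Set.mem_Ioc, not_and_or, not_lt, not_le] at hx
      rcases hx with hx | hx <;> nlinarith
  simp_rw [hslice]
  rw [lintegral_indicator measurableSet_Ioc, ← ofReal_integral_eq_lintegral_ofReal,
    ← intervalIntegral.integral_of_le (by linarith)]
  · congr 1
    rw [intervalIntegral.integral_eq_sub_of_hasDerivAt
      (f := fun x => p ^ 2 * (h ^ 2 * (x - c) - (x - c) ^ 3 / 3))]
    · ring
    · intro x _
      have hx : HasDerivAt (fun x : ℝ => x - c) 1 x := (hasDerivAt_id x).sub_const c
      refine (((hx.const_mul (h ^ 2)).sub ((hx.pow 3).div_const 3)).const_mul (p ^ 2)).congr_deriv ?_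
      norm_num
    · exact Continuous.intervalIntegrable (by fun_prop) _ _
  · exact Continuous.integrableOn_Ioc (by fun_prop)
  · refine (ae_restrict_iff' measurableSet_Ioc).2 (Filter.Eventually.of_forall fun x hx => ?_)
    have : 0 ≤ h ^ 2 - (x - c) ^ 2 := by nlinarith [hx.1, hx.2]
    exact mul_nonneg (sq_nonneg p) this

/-- A solution of `g'² = -c g` (`c > 0`) that is bounded below has nonnegative derivative. -/
theorem nonneg_of_sq_add_mul_eq_zero {g u v : ℝ → ℝ} {c K : ℝ} (hc : 0 < c)
    (hg : ∀ x, HasDerivAt g (u x) x) (hu : ∀ x, HasDerivAt u (v x) x)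
    (heq : ∀ x, u x ^ 2 + c * g x = 0) (hK : ∀ x, -K < g x) (a : ℝ) : 0 ≤ u a := by
  by_contra! ha
  have hderiv : ∀ x, u x * (2 * v x + c) = 0 := by
    intro x
    have h1 := ((hu x).pow 2).add ((hg x).const_mul c)
    have h2 : (u ^ 2 + fun y => c * g y) = fun _ => (0 : ℝ) := funext heq
    rw [h2] at h1
    have := h1.unique (hasDerivAt_const x (0 : ℝ))
    norm_num at this
    linarith
  have hbound : ∀ b, ∀ x ∈ Set.Icc a b, u x ≤ u a - c / 4 * (x - a) := by
    intro b
    refine image_le_of_deriv_right_lt_deriv_boundary (f' := v) (B' := fun _ => -(c / 4))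
      (fun x _ => (hu x).continuousAt.continuousWithinAt)
      (fun x _ => (hu x).hasDerivWithinAt) (by simp) (fun x => ?_) (fun x hx hux => ?_)
    · exact ((((hasDerivAt_id x).sub_const a).const_mul (c / 4)).const_sub (u a)).congr_deriv
        (by simp)
    · have hneg : u x < 0 := by nlinarith [hx.1]
      rcases mul_eq_zero.1 (hderiv x) with h | h <;> linarith
  have hKpos : 0 < K := by nlinarith [hK a, heq a, sq_nonneg (u a)]
  have hx : a ≤ a + 4 * (c * K + 1) / c := by
    have : 0 ≤ 4 * (c * K + 1) / c := by positivity
    linarith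
  have h1 := hbound _ _ ⟨hx, le_rfl⟩
  have h2 : c / 4 * (a + 4 * (c * K + 1) / c - a) = c * K + 1 := by
    field_simp
    ring
  rw [h2] at h1
  have h3 := heq (a + 4 * (c * K + 1) / c)
  have h4 := mul_lt_mul_of_pos_left (hK (a + 4 * (c * K + 1) / c)) hc
  have h5 : 0 < c * K := by positivity
  nlinarith

theorem eq_zero_of_sq_add_mul_eq_zero {g u v : ℝ → ℝ} {c K : ℝ} (hc : 0 < c)
    (hg : ∀ x, HasDerivAt g (u x) x) (hu : ∀ x, HasDerivAt u (v x) x)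
    (heq : ∀ x, u x ^ 2 + c * g x = 0) (hK : ∀ x, -K < g x) (a : ℝ) : g a = 0 := by
  have h1 := nonneg_of_sq_add_mul_eq_zero hc hg hu heq hK a
  have h2 := nonneg_of_sq_add_mul_eq_zero (g := fun x => g (-x)) (u := fun x => -u (-x))
    (v := fun x => v (-x)) hc
    (fun x => ((hg (-x)).comp x (hasDerivAt_neg x)).congr_deriv (by ring))
    (fun x => ((hu (-x)).comp x (hasDerivAt_neg x)).neg.congr_deriv (by ring))
    (fun x => by simpa using heq (-x)) (fun x => hK (-x)) (-a)
  rw [neg_neg] at h2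
  have h3 : u a = 0 := by linarith
  simpa [h3, hc.ne'] using heq a

theorem stmt_1 (p : ℝ) (hp : p > 0) (f : ℝ → ℝ) (hf : ContDiff ℝ 2 f)
    (hfp : ∀ x : ℝ, f x > p ^ 2 * x ^ 2) (A : ℝ) (hA : A > 0)
    (harea : ∀ xb : ℝ,
      volume {q : ℝ × ℝ | p ^ 2 * q.1 ^ 2 ≤ q.2 ∧
          q.2 ≤ f xb + deriv f xb * (q.1 - xb)} = ENNReal.ofReal A) :
    ∀ x : ℝ, f x = p ^ 2 * x ^ 2 + ((3 * p * A / 4) ^ ((1 : ℝ) / 3)) ^ 2 := by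
  set k := (3 * p * A / 4) ^ ((1 : ℝ) / 3) with hk
  have hkpos : 0 < k := by positivity
  have hk3 : k ^ 3 = 3 * p * A / 4 := by
    rw [hk, ← Real.rpow_natCast, ← Real.rpow_mul (by positivity)]
    norm_num
  have hode : ∀ x, (deriv f x - 2 * p ^ 2 * x) ^ 2 +
      4 * p ^ 2 * (f x - p ^ 2 * x ^ 2 - k ^ 2) = 0 := by
    intro x
    set m := deriv f x with hm
    set E := (m - 2 * p ^ 2 * x) ^ 2 / (4 * p ^ 4) + (f x - p ^ 2 * x ^ 2) / p ^ 2 with hE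
    have hEpos : 0 < E := by
      have : 0 < f x - p ^ 2 * x ^ 2 := sub_pos.2 (hfp x)
      positivity
    have hsq : √E ^ 2 = E := Real.sq_sqrt hEpos.le
    have hvol := volume_parabola_segment p (m / (2 * p ^ 2)) (√E) (Real.sqrt_nonneg E)
    have hline : ∀ y, p ^ 2 * y ^ 2 + p ^ 2 * (√E ^ 2 - (y - m / (2 * p ^ 2)) ^ 2) =
        f x + m * (y - x) := by
      intro y
      rw [hsq, hE]
      field_simp
      ring
    simp_rw [hline] at hvol
    rw [harea x, ENNReal.ofReal_eq_ofReal_iff hA.le (by positivity)] at hvol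
    have hkE : k = p * √E := by
      refine (pow_left_inj₀ hkpos.le (by positivity) three_ne_zero).1 ?_
      rw [hk3, hvol]
      ring
    rw [hkE, mul_pow, hsq, hE]
    field_simp
    ring
  have hdf : ∀ x, HasDerivAt f (deriv f x) x :=
    fun x => (hf.differentiable (by norm_num) x).hasDerivAt
  have hddf : ∀ x, HasDerivAt (deriv f) (deriv (deriv f) x) x := fun x =>
    (((contDiff_succ_iff_deriv (n := 1)).1 hf).2.2.differentiable (by norm_num) x).hasDerivAt
  intro x
  have := eq_zero_of_sq_add_mul_eq_zero (g := fun x => f x - p ^ 2 * x ^ 2 - k ^ 2)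
    (u := fun x => deriv f x - 2 * p ^ 2 * x) (v := fun x => deriv (deriv f) x - 2 * p ^ 2)
    (c := 4 * p ^ 2) (K := k ^ 2) (by positivity)
    (fun x => (((hdf x).sub ((hasDerivAt_pow 2 x).const_mul (p ^ 2))).sub_const _).congr_deriv
      (by norm_num; ring))
    (fun x => ((hddf x).sub ((hasDerivAt_id x).const_mul (2 * p ^ 2))).congr_deriv (by ring))
    hode (fun x => by linarith [hfp x]) x
  linarith
end

section
/- Let n ≥ 1, let p̄ ∈ ℝⁿ and (x̄, z̄) ∈ ℝⁿ × ℝ with z̄ > |x̄|². Let S = {(x,z) ∈ ℝⁿ × ℝ : |x|² ≤ z ≤ z̄ + ⟨p̄, x − x̄⟩} be the segment cut off by the hyperplane Υ : z = z̄ + ⟨p̄, x − x̄⟩ from the paraboloid z = |x|², let R = (p̄/2, |p̄|²/4) (the point where the hyperplane parallel to Υ and tangent to the paraboloid touches it), and let K be the convex hull of {R} ∪ (S ∩ Υ), the cone with the same base and axis as S. Then the volume of S equals (2(n+1)/(n+2)) times the volume of K. -/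
open MeasureTheory
open scoped RealInnerProductSpace

/-- The volume of a solid of revolution, by slicing into balls. -/
lemma volume_solid_of_revolution (n : ℕ) (r : ℝ → ℝ) (hr : Continuous r) (a : ℝ) (ha : 0 ≤ a)
    (hr0 : ∀ w, 0 ≤ w → 0 ≤ r w) :
    volume {q : EuclideanSpace ℝ (Fin n) × ℝ | (0 ≤ q.2 ∧ q.2 ≤ a) ∧ ‖q.1‖ ≤ r q.2} =
      ENNReal.ofReal (∫ w in (0 : ℝ)..a, r w ^ n) *
        volume (Metric.ball (0 : EuclideanSpace ℝ (Fin n)) 1) := by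
  have hm : MeasurableSet
      {q : EuclideanSpace ℝ (Fin n) × ℝ | (0 ≤ q.2 ∧ q.2 ≤ a) ∧ ‖q.1‖ ≤ r q.2} := by
    apply IsClosed.measurableSet
    refine IsClosed.and (IsClosed.and ?_ ?_) ?_
    · exact isClosed_le (by fun_prop) (by fun_prop)
    · exact isClosed_le (by fun_prop) (by fun_prop)
    · exact isClosed_le (by fun_prop) (by fun_prop)
  rw [Measure.volume_eq_prod, Measure.prod_apply_symm hm]
  have hslice : ∀ w : ℝ, volume ((fun x : EuclideanSpace ℝ (Fin n) => (x, w)) ⁻¹'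
      {q : EuclideanSpace ℝ (Fin n) × ℝ | (0 ≤ q.2 ∧ q.2 ≤ a) ∧ ‖q.1‖ ≤ r q.2}) =
      (Set.Icc 0 a).indicator (fun w => ENNReal.ofReal (r w ^ n) *
        volume (Metric.ball (0 : EuclideanSpace ℝ (Fin n)) 1)) w := by
    intro w
    by_cases hw : w ∈ Set.Icc 0 a
    · rw [Set.indicator_of_mem hw]
      have heq : ((fun x : EuclideanSpace ℝ (Fin n) => (x, w)) ⁻¹'
          {q : EuclideanSpace ℝ (Fin n) × ℝ | (0 ≤ q.2 ∧ q.2 ≤ a) ∧ ‖q.1‖ ≤ r q.2}) =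
          Metric.closedBall 0 (r w) := by
        ext x
        simp [hw.1, hw.2]
      rw [heq, Measure.addHaar_closedBall _ _ (hr0 w hw.1), finrank_euclideanSpace_fin]
    · rw [Set.indicator_of_notMem hw]
      have heq : ((fun x : EuclideanSpace ℝ (Fin n) => (x, w)) ⁻¹'
          {q : EuclideanSpace ℝ (Fin n) × ℝ | (0 ≤ q.2 ∧ q.2 ≤ a) ∧ ‖q.1‖ ≤ r q.2}) = ∅ := by
        ext x
        simp only [Set.mem_preimage, Set.mem_ofPred_eq, Set.mem_empty_iff_false, iff_false]
        exact fun h => hw h.1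
      rw [heq, measure_empty]
  simp_rw [hslice]
  rw [lintegral_indicator measurableSet_Icc, lintegral_mul_const _ (by fun_prop),
    intervalIntegral.integral_of_le ha, ← integral_Icc_eq_integral_Ioc,
    ofReal_integral_eq_lintegral_ofReal]
  · exact (hr.pow n).continuousOn.integrableOn_Icc
  · filter_upwards [ae_restrict_mem measurableSet_Icc] with w hw
    exact pow_nonneg (hr0 w hw.1) n

lemma integral_sqrt_pow (n : ℕ) {s : ℝ} (hs : 0 ≤ s) :
    ∫ w in (0 : ℝ)..s ^ 2, √w ^ n = 2 * s ^ (n + 2) / (n + 2) := by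
  have hcongr : ∫ w in (0 : ℝ)..s ^ 2, √w ^ n = ∫ w in (0 : ℝ)..s ^ 2, w ^ ((n : ℝ) / 2) := by
    apply intervalIntegral.integral_congr
    intro w hw
    rw [Set.uIcc_of_le (by positivity)] at hw
    simp only [Real.sqrt_eq_rpow]
    rw [← Real.rpow_natCast, ← Real.rpow_mul hw.1]
    congr 1
    ring
  have hn : (-1 : ℝ) < n / 2 := by
    have : (0 : ℝ) ≤ n / 2 := by positivity
    linarith
  have hpow : (s ^ 2) ^ ((n : ℝ) / 2 + 1) = s ^ (n + 2) := by
    rw [← Real.rpow_natCast s 2, ← Real.rpow_mul hs, ← Real.rpow_natCast s (n + 2)]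
    congr 1
    push_cast
    ring
  rw [hcongr, integral_rpow (Or.inl hn), hpow, Real.zero_rpow (by linarith)]
  field_simp
  ring

lemma integral_div_pow (n : ℕ) {s : ℝ} (hs : 0 < s) :
    ∫ w in (0 : ℝ)..s ^ 2, (w / s) ^ n = s ^ (n + 2) / (n + 1) := by
  simp_rw [div_pow]
  rw [intervalIntegral.integral_div, integral_pow]
  field_simp
  ring

/-- The affine shear that moves a translated paraboloid with tilted axis to standard position
preserves volume. -/
lemma measurePreserving_shear {n : ℕ} (c p : EuclideanSpace ℝ (Fin n)) (d : ℝ) :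
    MeasurePreserving (fun q : EuclideanSpace ℝ (Fin n) × ℝ => (q.1 - c, q.2 - ⟪p, q.1⟫ + d))
      volume volume := by
  rw [Measure.volume_eq_prod]
  refine (measurePreserving_sub_right volume c).skew_product
    (g := fun x z => z - ⟪p, x⟫ + d) (by fun_prop) ?_
  refine Filter.Eventually.of_forall fun x => ?_
  exact ((measurePreserving_add_right volume d).comp
    (measurePreserving_sub_right volume (⟪p, x⟫ : ℝ))).map_eq

/-- A solid cone over a Euclidean ball, with apex `(c, ⟪p, c⟫ - d)` and with its base on a
hyperplane of slope `p`, is the convex hull of its apex and its base. -/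
lemma convexHull_apex_base {n : ℕ} (c p : EuclideanSpace ℝ (Fin n)) (d s : ℝ) (hs : 0 < s) :
    convexHull ℝ (insert (c, ⟪p, c⟫ - d)
      {q : EuclideanSpace ℝ (Fin n) × ℝ | ‖q.1 - c‖ ≤ s ∧ q.2 - ⟪p, q.1⟫ + d = s ^ 2}) =
    {q | (0 ≤ q.2 - ⟪p, q.1⟫ + d ∧ q.2 - ⟪p, q.1⟫ + d ≤ s ^ 2) ∧
      ‖q.1 - c‖ ≤ (q.2 - ⟪p, q.1⟫ + d) / s} := by
  apply Set.Subset.antisymm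
  · apply convexHull_min
    · rintro q (rfl | ⟨h1, h2⟩)
      · simp [sq_nonneg]
      · refine ⟨⟨by rw [h2]; positivity, h2.le⟩, ?_⟩
        rw [h2, pow_two, mul_div_assoc, div_self hs.ne', mul_one]
        exact h1
    · rintro ⟨x, z⟩ ⟨⟨h1, h2⟩, h3⟩ ⟨x', z'⟩ ⟨⟨h1', h2'⟩, h3'⟩ a b ha hb hab
      simp only [Prod.smul_mk, Prod.mk_add_mk, Set.mem_ofPred_eq, smul_eq_mul] at *
      have hlin : a * z + b * z' - ⟪p, a • x + b • x'⟫ + d =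
          a * (z - ⟪p, x⟫ + d) + b * (z' - ⟪p, x'⟫ + d) := by
        rw [inner_add_right, inner_smul_right, inner_smul_right]
        linear_combination (-d) * hab
      have hc : a • x + b • x' - c = a • (x - c) + b • (x' - c) := by
        have : c = a • c + b • c := by rw [← add_smul, hab, one_smul]
        nth_rewrite 1 [this]
        module
      rw [hlin, hc]
      refine ⟨⟨by positivity, ?_⟩, ?_⟩
      · calc _ ≤ a * s ^ 2 + b * s ^ 2 := by gcongr
          _ = s ^ 2 := by rw [← add_mul, hab, one_mul]
      · calc _ ≤ ‖a • (x - c)‖ + ‖b • (x' - c)‖ := norm_add_le _ _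
          _ = a * ‖x - c‖ + b * ‖x' - c‖ := by
            rw [norm_smul, norm_smul, Real.norm_of_nonneg ha, Real.norm_of_nonneg hb]
          _ ≤ a * ((z - ⟪p, x⟫ + d) / s) + b * ((z' - ⟪p, x'⟫ + d) / s) := by gcongr
          _ = _ := by ring
  · rintro ⟨x, z⟩ ⟨⟨h1, h2⟩, h3⟩
    simp only at h1 h2 h3
    obtain ⟨w, hw⟩ : ∃ w, w = z - ⟪p, x⟫ + d := ⟨_, rfl⟩
    rw [← hw] at h1 h2 h3
    rcases h1.eq_or_lt with h0 | h0
    · apply subset_convexHull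
      left
      rw [← h0, zero_div] at h3
      have hx : x = c := sub_eq_zero.1 (norm_le_zero_iff.1 h3)
      subst hx
      ext1
      · rfl
      · simp only
        linarith
    · obtain ⟨t, ht⟩ : ∃ t, t = w / s ^ 2 := ⟨_, rfl⟩
      have ht0 : 0 < t := by rw [ht]; positivity
      have ht1 : t ≤ 1 := by rw [ht]; exact (div_le_one (by positivity)).2 h2
      have hwt : w = t * s ^ 2 := by rw [ht]; field_simp
      have hbase : (c + t⁻¹ • (x - c), s ^ 2 + ⟪p, c + t⁻¹ • (x - c)⟫ - d) ∈
          convexHull ℝ (insert (c, ⟪p, c⟫ - d)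
            {q : EuclideanSpace ℝ (Fin n) × ℝ |
              ‖q.1 - c‖ ≤ s ∧ q.2 - ⟪p, q.1⟫ + d = s ^ 2}) := by
        apply subset_convexHull
        right
        refine ⟨?_, by simp only; ring⟩
        simp only [add_sub_cancel_left, norm_smul, norm_inv, Real.norm_of_nonneg ht0.le]
        rw [inv_mul_le_iff₀ ht0]
        refine h3.trans_eq ?_
        rw [hwt]
        field_simp
      have hapex : (c, ⟪p, c⟫ - d) ∈
          convexHull ℝ (insert (c, ⟪p, c⟫ - d)
            {q : EuclideanSpace ℝ (Fin n) × ℝ |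
              ‖q.1 - c‖ ≤ s ∧ q.2 - ⟪p, q.1⟫ + d = s ^ 2}) :=
        subset_convexHull _ _ (Set.mem_insert _ _)
      have hcomb := (convex_convexHull ℝ _) hapex hbase (sub_nonneg.2 ht1) ht0.le
        (sub_add_cancel 1 t)
      convert hcomb using 1
      ext1
      · simp only [Prod.smul_mk, Prod.mk_add_mk, smul_add, smul_smul, mul_inv_cancel₀ ht0.ne']
        module
      · simp only [Prod.smul_mk, Prod.mk_add_mk, smul_eq_mul, inner_add_right, inner_smul_right,
          inner_sub_right]
        field_simp
        linarith

theorem stmt_3 (n : ℕ) (hn : 1 ≤ n) (pb xb : EuclideanSpace ℝ (Fin n)) (zb : ℝ)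
    (hz : zb > ‖xb‖ ^ 2)
    (S : Set (EuclideanSpace ℝ (Fin n) × ℝ))
    (hS : S = {q | ‖q.1‖ ^ 2 ≤ q.2 ∧ q.2 ≤ zb + ⟪pb, q.1 - xb⟫})
    (R : EuclideanSpace ℝ (Fin n) × ℝ)
    (hR : R = ((1 / 2 : ℝ) • pb, ‖pb‖ ^ 2 / 4))
    (K : Set (EuclideanSpace ℝ (Fin n) × ℝ))
    (hK : K = convexHull ℝ (insert R {q ∈ S | q.2 = zb + ⟪pb, q.1 - xb⟫})) :
    volume S = ENNReal.ofReal (2 * (n + 1) / (n + 2)) * volume K := by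
  obtain ⟨c, hc⟩ : ∃ c, c = (1 / 2 : ℝ) • pb := ⟨_, rfl⟩
  obtain ⟨d, hd⟩ : ∃ d, d = ‖pb‖ ^ 2 / 4 := ⟨_, rfl⟩
  have hsq : ∀ x, ‖x - c‖ ^ 2 = ‖x‖ ^ 2 - ⟪pb, x⟫ + d := by
    intro x
    rw [norm_sub_sq_real, hc, hd, inner_smul_right, norm_smul, real_inner_comm,
      Real.norm_of_nonneg (by norm_num)]
    ring
  have hpos : 0 < zb - ⟪pb, xb⟫ + d := by
    have := hsq xb
    have := sq_nonneg ‖xb - c‖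
    linarith
  obtain ⟨s, hs, hs2⟩ : ∃ s, 0 < s ∧ s ^ 2 = zb - ⟪pb, xb⟫ + d :=
    ⟨_, Real.sqrt_pos.2 hpos, Real.sq_sqrt hpos.le⟩
  have hSpre : S = (fun q : EuclideanSpace ℝ (Fin n) × ℝ => (q.1 - c, q.2 - ⟪pb, q.1⟫ + d)) ⁻¹'
      {q | (0 ≤ q.2 ∧ q.2 ≤ s ^ 2) ∧ ‖q.1‖ ≤ √q.2} := by
    rw [hS]
    ext ⟨x, z⟩
    simp only [Set.mem_ofPred_eq, Set.mem_preimage, inner_sub_right]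
    have hx := hsq x
    have hx0 := sq_nonneg ‖x - c‖
    constructor
    · rintro ⟨h1, h2⟩
      exact ⟨⟨by linarith, by linarith⟩, Real.le_sqrt_of_sq_le (by linarith)⟩
    · rintro ⟨⟨h1, h2⟩, h3⟩
      rw [Real.le_sqrt (norm_nonneg _) h1] at h3
      exact ⟨by linarith, by linarith⟩
  have hKpre : K = (fun q : EuclideanSpace ℝ (Fin n) × ℝ => (q.1 - c, q.2 - ⟪pb, q.1⟫ + d)) ⁻¹'
      {q | (0 ≤ q.2 ∧ q.2 ≤ s ^ 2) ∧ ‖q.1‖ ≤ q.2 / s} := by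
    refine Eq.trans ?_ (convexHull_apex_base c pb d s hs)
    have hR' : R = (c, ⟪pb, c⟫ - d) := by
      rw [hR, hc, hd, inner_smul_right, real_inner_self_eq_norm_sq]
      congr 1
      ring
    rw [hK, hR']
    congr 2
    ext ⟨x, z⟩
    have hx := hsq x
    simp only [hS, Set.mem_ofPred_eq, inner_sub_right]
    rw [← sq_le_sq₀ (norm_nonneg _) hs.le]
    constructor
    · rintro ⟨⟨h1, h2⟩, h3⟩
      exact ⟨by linarith, by linarith⟩
    · rintro ⟨h1, h2⟩
      exact ⟨⟨by linarith, by linarith⟩, by linarith⟩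
  have hcont : Continuous fun w : ℝ => w / s := continuous_id.div_const s
  have hvol : ∀ r : ℝ → ℝ, Continuous r → (∀ w, 0 ≤ w → 0 ≤ r w) →
      volume ((fun q : EuclideanSpace ℝ (Fin n) × ℝ => (q.1 - c, q.2 - ⟪pb, q.1⟫ + d)) ⁻¹'
        {q | (0 ≤ q.2 ∧ q.2 ≤ s ^ 2) ∧ ‖q.1‖ ≤ r q.2}) =
      ENNReal.ofReal (∫ w in (0 : ℝ)..s ^ 2, r w ^ n) *
        volume (Metric.ball (0 : EuclideanSpace ℝ (Fin n)) 1) := by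
    intro r hr hr0
    rw [← volume_solid_of_revolution n r hr _ (sq_nonneg s) hr0]
    refine (measurePreserving_shear c pb d).measure_preimage (MeasurableSet.nullMeasurableSet ?_)
    have := hr.measurable
    measurability
  rw [hSpre, hKpre, hvol _ Real.continuous_sqrt fun w _ => Real.sqrt_nonneg w,
    hvol _ hcont fun w hw => div_nonneg hw hs.le, integral_sqrt_pow n hs.le,
    integral_div_pow n hs, ← mul_assoc, ← ENNReal.ofReal_mul (by positivity)]
  congr 2
  field_simp
end

section
/- Let n ≥ 1, let p̄ ∈ ℝⁿ and (x̄, z̄) ∈ ℝⁿ × ℝ, and set d = z̄ − ⟨p̄, x̄⟩ and q = 1 − |p̄|². Suppose q > 0 and d ≥ √q, and set ζ_P = d/√q. Then the volume of the compact set S = {(x,z) ∈ ℝⁿ × ℝ : z ≥ 1, |x|² ≤ z² − 1, z ≤ z̄ + ⟨p̄, x − x̄⟩}, cut off by the hyperplane z − z̄ = ⟨p̄, x − x̄⟩ from the solid upper sheet H = {(x,z) : z ≥ 1, |x|² ≤ z² − 1} of the two-sheeted hyperboloid z² − |x|² = 1, equals (π^{n/2} / Γ(n/2 + 1)) · ∫₁^{ζ_P}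 (ζ² − 1)^{n/2} dζ. -/
open MeasureTheory
open scoped RealInnerProductSpace

section Ellipsoid

variable {E : Type*} [NormedAddCommGroup E] [InnerProductSpace ℝ E]

lemma norm_transvection_sq {p : E} {s : ℝ} (hs : 0 < s) (hp : ‖p‖ ^ 2 = 1 - s ^ 2) (y : E) :
    ‖LinearMap.transvection (-(1 + s)⁻¹ • innerₗ E p) p y‖ ^ 2 = ‖y‖ ^ 2 - ⟪p, y⟫ ^ 2 := by
  have h1 : (1 + s) ≠ 0 := by positivity
  simp only [LinearMap.transvection.apply, LinearMap.smul_apply, innerₗ_apply_apply, smul_eq_mul]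
  rw [norm_add_sq_real, norm_smul, mul_pow, Real.norm_eq_abs, sq_abs, hp, inner_smul_right,
    real_inner_comm]
  field_simp
  ring

lemma det_transvection_eq [FiniteDimensional ℝ E] {p : E} {s : ℝ} (hs : 0 < s)
    (hp : ‖p‖ ^ 2 = 1 - s ^ 2) :
    LinearMap.det (LinearMap.transvection (-(1 + s)⁻¹ • innerₗ E p) p) = s := by
  have h1 : (1 + s) ≠ 0 := by positivity
  rw [LinearMap.transvection.det]
  simp only [LinearMap.smul_apply, innerₗ_apply_apply, smul_eq_mul, real_inner_self_eq_norm_sq, hp]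
  field_simp
  ring

/-- Points of the upper sheet lie on or above the supporting hyperplane with slope `p`. -/
lemma le_height_of_mem_upper_sheet {p : E} {s : ℝ} (hs : 0 < s) (hp : ‖p‖ ^ 2 = 1 - s ^ 2)
    {x : E} {t : ℝ} (h1 : 1 ≤ t + ⟪p, x⟫) (h2 : ‖x‖ ^ 2 ≤ (t + ⟪p, x⟫) ^ 2 - 1) : s ≤ t := by
  have hcs : ⟪p, x⟫ ^ 2 ≤ ‖p‖ ^ 2 * ‖x‖ ^ 2 := by
    rw [← mul_pow, ← sq_abs]
    exact pow_le_pow_left₀ (abs_nonneg _) (abs_real_inner_le_norm p x) 2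
  set a := ⟪p, x⟫
  have hs1 : s ≤ 1 := by nlinarith [sq_nonneg ‖p‖]
  have h3 : ‖p‖ ^ 2 * ‖x‖ ^ 2 ≤ ‖p‖ ^ 2 * ((t + a) ^ 2 - 1) := by gcongr
  have h4 : a ^ 2 ≤ (t + a - s) ^ 2 := by
    rw [hp] at h3 hcs
    nlinarith [sq_nonneg (1 - s * (t + a))]
  have := (abs_le_of_sq_le_sq' h4 (by linarith)).2
  linarith

lemma upper_sheet_slice_eq {p : E} {s : ℝ} (hs : 0 < s) (hp : ‖p‖ ^ 2 = 1 - s ^ 2)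
    {t : ℝ} (ht : s ≤ t) :
    {x : E | 1 ≤ t + ⟪p, x⟫ ∧ ‖x‖ ^ 2 ≤ (t + ⟪p, x⟫) ^ 2 - 1} =
      (fun x ↦ x - (t / s ^ 2) • p) ⁻¹'
        (LinearMap.transvection (-(1 + s)⁻¹ • innerₗ E p) p ⁻¹'
          Metric.closedBall 0 √((t / s) ^ 2 - 1)) := by
  ext x
  have hr : 0 ≤ (t / s) ^ 2 - 1 := by
    have : 1 ≤ t / s := (one_le_div hs).2 ht
    nlinarith
  have key : ‖x - (t / s ^ 2) • p‖ ^ 2 - ⟪p, x - (t / s ^ 2) • p⟫ ^ 2 - ((t / s) ^ 2 - 1)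
      = ‖x‖ ^ 2 - ((t + ⟪p, x⟫) ^ 2 - 1) := by
    rw [norm_sub_sq_real, norm_smul, mul_pow, Real.norm_eq_abs, sq_abs, inner_sub_right,
      inner_smul_right, inner_smul_right, real_inner_self_eq_norm_sq, hp, real_inner_comm x p]
    field_simp
    ring
  simp only [Set.mem_ofPred_eq, Set.mem_preimage, mem_closedBall_zero_iff]
  rw [Real.le_sqrt (norm_nonneg _) hr, norm_transvection_sq hs hp,
    ← sub_nonpos (b := (t / s) ^ 2 - 1), key, sub_nonpos, and_iff_right_iff_imp]
  intro h
  have hp1 : ‖p‖ ≤ 1 := by nlinarith [norm_nonneg p, sq_nonneg s]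
  have hcs : |⟪p, x⟫| ≤ ‖x‖ :=
    (abs_real_inner_le_norm p x).trans (mul_le_of_le_one_left (norm_nonneg x) hp1)
  by_contra! hlt
  have h1 : 1 ≤ |t + ⟪p, x⟫| := by
    rw [← sq_le_sq₀ zero_le_one (abs_nonneg _), sq_abs]
    nlinarith [sq_nonneg ‖x‖]
  have h2 : t + ⟪p, x⟫ ≤ -1 := by
    rcases le_abs.1 h1 with h | h <;> linarith
  have h3 := neg_abs_le ⟪p, x⟫
  nlinarith [norm_nonneg x]

lemma volume_upper_sheet_slice [FiniteDimensional ℝ E] [MeasurableSpace E] [BorelSpace E]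
    [Nontrivial E] {p : E} {s : ℝ} (hs : 0 < s) (hp : ‖p‖ ^ 2 = 1 - s ^ 2)
    {t : ℝ} (ht : s ≤ t) :
    volume {x : E | 1 ≤ t + ⟪p, x⟫ ∧ ‖x‖ ^ 2 ≤ (t + ⟪p, x⟫) ^ 2 - 1} =
      ENNReal.ofReal (Real.pi ^ ((Module.finrank ℝ E : ℝ) / 2) /
          Real.Gamma ((Module.finrank ℝ E : ℝ) / 2 + 1) *
        (s⁻¹ * ((t / s) ^ 2 - 1) ^ ((Module.finrank ℝ E : ℝ) / 2))) := by
  have hr : 0 ≤ (t / s) ^ 2 - 1 := by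
    have : 1 ≤ t / s := (one_le_div hs).2 ht
    nlinarith
  have hdet := det_transvection_eq hs hp
  simp only [upper_sheet_slice_eq hs hp ht, sub_eq_add_neg _ ((t / s ^ 2) • p)]
  rw [measure_preimage_add_right,
    Measure.addHaar_preimage_linearMap _ (by rw [hdet]; exact hs.ne'), hdet,
    InnerProductSpace.volume_closedBall, abs_of_pos (by positivity),
    ← ENNReal.ofReal_pow (Real.sqrt_nonneg _), ← ENNReal.ofReal_mul (by positivity),
    ← ENNReal.ofReal_mul (by positivity)]
  have hpow : ∀ {a : ℝ}, 0 ≤ a →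
      √a ^ Module.finrank ℝ E = a ^ ((Module.finrank ℝ E : ℝ) / 2) := fun {a} ha ↦ by
    rw [Real.sqrt_eq_rpow, ← Real.rpow_mul_natCast ha]
    ring_nf
  rw [hpow hr, hpow Real.pi_pos.le]
  ring_nf

/-- The shear `(x, t) ↦ (x, t + ⟪p, x⟫)` preserves volume. -/
lemma measurePreserving_shear_s6 [FiniteDimensional ℝ E] [MeasurableSpace E] [BorelSpace E] (p : E) :
    MeasurePreserving (fun w : E × ℝ ↦ (w.1, w.2 + ⟪p, w.1⟫)) volume volume := by
  refine (MeasurePreserving.id volume).skew_product (g := fun x t ↦ t + ⟪p, x⟫) ?_ ?_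
  · exact Continuous.measurable (by unfold Function.uncurry; fun_prop)
  · exact Filter.Eventually.of_forall fun x ↦ map_add_right_eq_self volume _

end Ellipsoid

lemma lintegral_slice_eq {n : ℕ} (hn : 1 ≤ n) {s d C : ℝ} (hs : 0 < s) (hd : s ≤ d) (hC : 0 ≤ C) :
    ∫⁻ t in Set.Icc s d,
        ENNReal.ofReal (C * (s⁻¹ * ((t / s) ^ 2 - 1) ^ ((n : ℝ) / 2))) =
      ENNReal.ofReal (C * ∫ ζ in (1 : ℝ)..(d / s), (ζ ^ 2 - 1) ^ ((n : ℝ) / 2)) := by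
  have hcont : Continuous fun t : ℝ ↦ C * (s⁻¹ * ((t / s) ^ 2 - 1) ^ ((n : ℝ) / 2)) := by
    have : Continuous fun t : ℝ ↦ ((t / s) ^ 2 - 1) ^ ((n : ℝ) / 2) :=
      Continuous.rpow_const (by fun_prop) fun _ ↦ Or.inr (by positivity)
    fun_prop
  rw [← ofReal_integral_eq_lintegral_ofReal hcont.continuousOn.integrableOn_Icc,
    integral_Icc_eq_integral_Ioc, ← intervalIntegral.integral_of_le hd,
    intervalIntegral.integral_const_mul, intervalIntegral.integral_const_mul,
    intervalIntegral.integral_comp_div (fun ζ : ℝ ↦ (ζ ^ 2 - 1) ^ ((n : ℝ) / 2)) hs.ne',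
    div_self hs.ne', smul_eq_mul, inv_mul_cancel_left₀ hs.ne']
  filter_upwards [ae_restrict_mem measurableSet_Icc] with t ht
  have : 1 ≤ t / s := (one_le_div hs).2 ht.1
  have : 0 ≤ (t / s) ^ 2 - 1 := by nlinarith
  simp only [Pi.zero_apply]
  positivity

theorem stmt_6 (n : ℕ) (hn : 1 ≤ n) (pb xb : EuclideanSpace ℝ (Fin n)) (zb : ℝ)
    (d q : ℝ) (hd : d = zb - ⟪pb, xb⟫) (hq : q = 1 - ‖pb‖ ^ 2)
    (hq0 : q > 0) (hdq : d ≥ Real.sqrt q) :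
    volume {w : EuclideanSpace ℝ (Fin n) × ℝ |
        1 ≤ w.2 ∧ ‖w.1‖ ^ 2 ≤ w.2 ^ 2 - 1 ∧ w.2 ≤ zb + ⟪pb, w.1 - xb⟫} =
      ENNReal.ofReal (Real.pi ^ ((n : ℝ) / 2) / Real.Gamma ((n : ℝ) / 2 + 1) *
        ∫ ζ in (1 : ℝ)..(d / Real.sqrt q), (ζ ^ 2 - 1) ^ ((n : ℝ) / 2)) := by
  have : Nonempty (Fin n) := ⟨⟨0, hn⟩⟩
  have hs : 0 < √q := Real.sqrt_pos.2 hq0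
  have hp : ‖pb‖ ^ 2 = 1 - √q ^ 2 := by rw [Real.sq_sqrt hq0.le]; linarith
  set S := {w : EuclideanSpace ℝ (Fin n) × ℝ |
        1 ≤ w.2 ∧ ‖w.1‖ ^ 2 ≤ w.2 ^ 2 - 1 ∧ w.2 ≤ zb + ⟪pb, w.1 - xb⟫} with hS
  have hmeas : MeasurableSet S := by
    have h1 : IsClosed {w : EuclideanSpace ℝ (Fin n) × ℝ | 1 ≤ w.2} :=
      isClosed_le (by fun_prop) (by fun_prop)
    have h2 : IsClosed {w : EuclideanSpace ℝ (Fin n) × ℝ | ‖w.1‖ ^ 2 ≤ w.2 ^ 2 - 1} :=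
      isClosed_le (by fun_prop) (by fun_prop)
    have h3 : IsClosed {w : EuclideanSpace ℝ (Fin n) × ℝ | w.2 ≤ zb + ⟪pb, w.1 - xb⟫} :=
      isClosed_le (by fun_prop) (by fun_prop)
    exact (h1.inter (h2.inter h3)).measurableSet
  have hshear := measurePreserving_shear_s6 pb
  have hslice : ∀ t : ℝ, volume ((fun x ↦ (x, t)) ⁻¹'
      ((fun w : EuclideanSpace ℝ (Fin n) × ℝ ↦ (w.1, w.2 + ⟪pb, w.1⟫)) ⁻¹' S)) =
      (Set.Icc √q d).indicator (fun t ↦ ENNReal.ofReal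
        (Real.pi ^ ((n : ℝ) / 2) / Real.Gamma ((n : ℝ) / 2 + 1) *
          ((√q)⁻¹ * ((t / √q) ^ 2 - 1) ^ ((n : ℝ) / 2)))) t := by
    intro t
    have hmem : ∀ x : EuclideanSpace ℝ (Fin n),
        t + ⟪pb, x⟫ ≤ zb + ⟪pb, x - xb⟫ ↔ t ≤ d := fun x ↦ by
      rw [inner_sub_right, hd]
      constructor <;> intro h <;> linarith
    simp only [hS, Set.preimage_ofPred_eq, hmem]
    by_cases ht : t ∈ Set.Icc √q d
    · have := volume_upper_sheet_slice hs hp ht.1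
      rw [finrank_euclideanSpace_fin] at this
      rw [Set.indicator_of_mem ht, ← this]
      simp only [ht.2, and_true]
    · rw [Set.indicator_of_notMem ht]
      convert measure_empty (μ := volume)
      refine Set.eq_empty_of_forall_notMem fun x hx ↦ ht ?_
      exact ⟨le_height_of_mem_upper_sheet hs hp hx.1 hx.2.1, hx.2.2⟩
  rw [← hshear.measure_preimage hmeas.nullMeasurableSet, Measure.volume_eq_prod,
    Measure.prod_apply_symm (hshear.measurable hmeas), lintegral_congr hslice,
    lintegral_indicator measurableSet_Icc, lintegral_slice_eq hn hs hdq]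
  have := Real.Gamma_pos_of_pos (show (0 : ℝ) < (n : ℝ) / 2 + 1 by positivity)
  positivity
end

section
/- Let n ≥ 1, let p̄ ∈ ℝⁿ and (x̄, z̄) ∈ ℝⁿ × ℝ, and set d = z̄ − ⟨p̄, x̄⟩ and q = 1 − |p̄|². Suppose q > 0 and d > √q, and set ζ_P = d/√q (so ζ_P > 1). Let S = {(x,z) ∈ ℝⁿ × ℝ : z ≥ 1, |x|² ≤ z² − 1, z ≤ z̄ + ⟨p̄, x − x̄⟩} be the hyperboloidal segment cut off by the hyperplane Υ : z = z̄ + ⟨p̄, x − x̄⟩ from H = {(x,z) : z ≥ 1, |x|² ≤ z² − 1}, let R = (p̄/√q, 1/√q) (the point where the hyperplane parallel to Υ and tangent to the hyperboloid z² − |x|² = 1 touches its upper sheet), and let K be the convex hull of {R} ∪ (S ∩ Υ), the cone with the same base and axis as S. Then volume(S) / volume(K) = (n+1) / ((ζ_P² − 1)^{n/2} (ζ_P − 1)) · ∫₁^{ζ_P} (ζ² − 1)^{n/2} dζ. -/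
open MeasureTheory
open scoped RealInnerProductSpace

section Boost

variable {V : Type*} [NormedAddCommGroup V] [InnerProductSpace ℝ V]

/-- The Lorentz boost of `V × ℝ` with velocity `p`, where `s` stands for `√(1 - ‖p‖²)`. -/
noncomputable def lorentzBoost (p : V) (s : ℝ) : V × ℝ →ₗ[ℝ] V × ℝ where
  toFun w := (w.1 + (⟪p, w.1⟫ / (s * (1 + s)) + w.2 / s) • p, (⟪p, w.1⟫ + w.2) / s)
  map_add' v w := by
    ext
    · simp only [Prod.fst_add, Prod.snd_add, inner_add_right]
      module
    · simp only [Prod.fst_add, Prod.snd_add, inner_add_right]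
      ring
  map_smul' c w := by
    ext
    · simp only [Prod.smul_fst, Prod.smul_snd, inner_smul_right, smul_eq_mul, RingHom.id_apply]
      module
    · simp only [Prod.smul_fst, Prod.smul_snd, inner_smul_right, smul_eq_mul, RingHom.id_apply]
      ring

variable {p : V} {s : ℝ}

theorem lorentzBoost_height (hs : 0 < s) (hp : ‖p‖ ^ 2 = 1 - s ^ 2) (w : V × ℝ) :
    (lorentzBoost p s w).2 - ⟪p, (lorentzBoost p s w).1⟫ = s * w.2 := by
  have h1 : 1 + s ≠ 0 := by positivity
  simp only [lorentzBoost, LinearMap.coe_mk, AddHom.coe_mk, inner_add_right, inner_smul_right,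
    real_inner_self_eq_norm_sq, hp]
  field_simp
  ring

theorem lorentzBoost_quadratic (hs : 0 < s) (hp : ‖p‖ ^ 2 = 1 - s ^ 2) (w : V × ℝ) :
    (lorentzBoost p s w).2 ^ 2 - ‖(lorentzBoost p s w).1‖ ^ 2 = w.2 ^ 2 - ‖w.1‖ ^ 2 := by
  have h1 : 1 + s ≠ 0 := by positivity
  simp only [lorentzBoost, LinearMap.coe_mk, AddHom.coe_mk, norm_add_sq_real, inner_smul_right,
    norm_smul, mul_pow, hp, Real.norm_eq_abs, sq_abs, real_inner_comm p w.1]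
  field_simp
  ring

theorem lorentzBoost_injective (hs : 0 < s) (hp : ‖p‖ ^ 2 = 1 - s ^ 2) :
    Function.Injective (lorentzBoost p s) := by
  rw [← LinearMap.ker_eq_bot, LinearMap.ker_eq_bot']
  intro w hw
  have h1 := lorentzBoost_height hs hp w
  have h2 := lorentzBoost_quadratic hs hp w
  simp only [hw, Prod.snd_zero, Prod.fst_zero, inner_zero_right, norm_zero, sub_zero] at h1 h2
  have h3 : w.2 = 0 := by
    rcases mul_eq_zero.1 h1.symm with h | h
    · exact absurd h hs.ne'
    · exact h
  have h4 : ‖w.1‖ ^ 2 = 0 := by rw [h3] at h2; linarith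
  ext
  · simpa using h4
  · exact h3

theorem abs_inner_lt_of_norm_sq_lt (hs : 0 < s) (hp : ‖p‖ ^ 2 = 1 - s ^ 2) {x : V} {z : ℝ}
    (hz : 0 < z) (hx : ‖x‖ ^ 2 < z ^ 2) : |⟪p, x⟫| < z := by
  have hp1 : ‖p‖ ≤ 1 := by nlinarith [norm_nonneg p]
  have hx1 : ‖x‖ < z := lt_of_pow_lt_pow_left₀ 2 hz.le hx
  calc |⟪p, x⟫| ≤ ‖p‖ * ‖x‖ := abs_real_inner_le_norm p x
    _ ≤ 1 * ‖x‖ := by gcongr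
    _ < z := by linarith

theorem lorentzBoost_mem_hyperboloid (hs : 0 < s) (hp : ‖p‖ ^ 2 = 1 - s ^ 2) (w : V × ℝ) :
    (1 ≤ (lorentzBoost p s w).2 ∧
      ‖(lorentzBoost p s w).1‖ ^ 2 ≤ (lorentzBoost p s w).2 ^ 2 - 1) ↔
    (1 ≤ w.2 ∧ ‖w.1‖ ^ 2 ≤ w.2 ^ 2 - 1) := by
  have h1 := lorentzBoost_height hs hp w
  have h2 := lorentzBoost_quadratic hs hp w
  have h3 : (lorentzBoost p s w).2 = (⟪p, w.1⟫ + w.2) / s := rfl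
  generalize lorentzBoost p s w = v at h1 h2 h3 ⊢
  constructor
  · rintro ⟨hz, hx⟩
    have h4 := (abs_lt.1 (abs_inner_lt_of_norm_sq_lt hs hp (by linarith)
      (by linarith : ‖v.1‖ ^ 2 < v.2 ^ 2))).2
    have h5 : 0 < w.2 := pos_of_mul_pos_right (a := s) (by linarith) hs.le
    refine ⟨?_, by linarith⟩
    nlinarith [sq_nonneg ‖w.1‖]
  · rintro ⟨hz, hx⟩
    have h4 := (abs_lt.1 (abs_inner_lt_of_norm_sq_lt hs hp (by linarith)
      (by linarith : ‖w.1‖ ^ 2 < w.2 ^ 2))).1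
    have h5 : 0 < v.2 := by
      rw [h3]
      exact div_pos (by linarith) hs
    refine ⟨?_, by linarith⟩
    nlinarith [sq_nonneg ‖v.1‖]

end Boost

theorem convexHull_insert_disk {V : Type*} [NormedAddCommGroup V] [NormedSpace ℝ V]
    {a b k : ℝ} (hab : a < b) :
    convexHull ℝ (insert ((0 : V), a) {w : V × ℝ | ‖w.1‖ ≤ k * (b - a) ∧ w.2 = b}) =
      {w : V × ℝ | w.2 ∈ Set.Icc a b ∧ ‖w.1‖ ≤ k * (w.2 - a)} := by
  apply Set.Subset.antisymm
  · apply convexHull_min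
    · rintro w (rfl | ⟨h1, h2⟩)
      · simp [hab.le]
      · exact ⟨by simp [h2, hab.le], by rw [h2]; exact h1⟩
    · rintro v ⟨⟨hv1, hv2⟩, hv3⟩ w ⟨⟨hw1, hw2⟩, hw3⟩ α β hα hβ hαβ
      refine ⟨convex_Icc a b ⟨hv1, hv2⟩ ⟨hw1, hw2⟩ hα hβ hαβ, ?_⟩
      calc ‖α • v.1 + β • w.1‖ ≤ α * ‖v.1‖ + β * ‖w.1‖ := by
            refine (norm_add_le _ _).trans_eq ?_
            rw [norm_smul, norm_smul, Real.norm_of_nonneg hα, Real.norm_of_nonneg hβ]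
        _ ≤ α * (k * (v.2 - a)) + β * (k * (w.2 - a)) := by gcongr
        _ = k * (α * v.2 + β * w.2 - (α + β) * a) := by ring
        _ = k * ((α • v + β • w).2 - a) := by simp [hαβ]
  · rintro ⟨y, z⟩ ⟨⟨h1, h2⟩, h3⟩
    simp only at h1 h2 h3
    rcases h1.eq_or_lt with rfl | h1
    · apply subset_convexHull
      left
      simpa using h3
    · have hz : 0 < z - a := sub_pos.2 h1
      have hb : 0 < b - a := sub_pos.2 hab
      have hmem : (((b - a) / (z - a)) • y, b) ∈
          {w : V × ℝ | ‖w.1‖ ≤ k * (b - a) ∧ w.2 = b} := by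
        refine ⟨?_, rfl⟩
        simp only
        rw [norm_smul, Real.norm_of_nonneg (by positivity), div_mul_eq_mul_div, div_le_iff₀ hz]
        nlinarith
      apply segment_subset_convexHull (Set.mem_insert _ _) (Set.mem_insert_of_mem _ hmem)
      refine ⟨(b - z) / (b - a), (z - a) / (b - a), div_nonneg (by linarith) hb.le,
        by positivity, by field_simp; ring, ?_⟩
      ext
      · simp only [Prod.smul_mk, Prod.mk_add_mk, smul_zero, zero_add, smul_smul]
        rw [div_mul_div_cancel₀ hb.ne', div_self hz.ne', one_smul]
      · simp only [Prod.smul_mk, Prod.mk_add_mk, smul_eq_mul]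
        field_simp
        ring

theorem volume_solid_of_revolution_s7 (n : ℕ) {a b : ℝ} (hab : a ≤ b) {f : ℝ → ℝ}
    (hf : Continuous f) (hf0 : ∀ z ∈ Set.Icc a b, 0 ≤ f z) :
    volume {w : EuclideanSpace ℝ (Fin n) × ℝ | w.2 ∈ Set.Icc a b ∧ ‖w.1‖ ≤ f w.2} =
      ENNReal.ofReal (∫ z in a..b, f z ^ n) *
        volume (Metric.ball (0 : EuclideanSpace ℝ (Fin n)) 1) := by
  have hm : MeasurableSet
      {w : EuclideanSpace ℝ (Fin n) × ℝ | w.2 ∈ Set.Icc a b ∧ ‖w.1‖ ≤ f w.2} :=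
    (measurable_snd measurableSet_Icc).inter
      (measurableSet_le measurable_fst.norm (hf.measurable.comp measurable_snd))
  have hsec : ∀ z, volume ((fun x : EuclideanSpace ℝ (Fin n) => (x, z)) ⁻¹'
      {w : EuclideanSpace ℝ (Fin n) × ℝ | w.2 ∈ Set.Icc a b ∧ ‖w.1‖ ≤ f w.2}) =
      (Set.Icc a b).indicator (fun z => ENNReal.ofReal (f z ^ n) *
        volume (Metric.ball (0 : EuclideanSpace ℝ (Fin n)) 1)) z := by
    intro z
    by_cases hz : z ∈ Set.Icc a b
    · rw [Set.indicator_of_mem hz]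
      have : (fun x : EuclideanSpace ℝ (Fin n) => (x, z)) ⁻¹'
          {w : EuclideanSpace ℝ (Fin n) × ℝ | w.2 ∈ Set.Icc a b ∧ ‖w.1‖ ≤ f w.2} =
          Metric.closedBall 0 (f z) := by
        ext x
        simp only [Set.mem_preimage, Set.mem_ofPred_eq, hz, true_and, mem_closedBall_zero_iff]
      rw [this, Measure.addHaar_closedBall _ _ (hf0 z hz), finrank_euclideanSpace_fin]
    · rw [Set.indicator_of_notMem hz]
      convert measure_empty (μ := (volume : Measure (EuclideanSpace ℝ (Fin n))))
      exact Set.eq_empty_of_forall_notMem fun x hx => hz hx.1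
  rw [Measure.volume_eq_prod, Measure.prod_apply_symm hm]
  simp_rw [hsec]
  rw [lintegral_indicator measurableSet_Icc, lintegral_mul_const _ (by fun_prop),
    intervalIntegral.integral_of_le hab, ← integral_Icc_eq_integral_Ioc,
    ofReal_integral_eq_lintegral_ofReal]
  · exact (hf.pow n).continuousOn.integrableOn_Icc
  · filter_upwards [ae_restrict_mem measurableSet_Icc] with z hz
    exact pow_nonneg (hf0 z hz) n

theorem sqrt_pow_eq_rpow_half {x : ℝ} (hx : 0 ≤ x) (n : ℕ) :
    √x ^ n = x ^ ((n : ℝ) / 2) := by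
  rw [Real.rpow_div_two_eq_sqrt _ hx, Real.rpow_natCast]

theorem volume_ratio_upright (n : ℕ) {c : ℝ} (hc : 1 < c) :
    volume {w : EuclideanSpace ℝ (Fin n) × ℝ | w.2 ∈ Set.Icc 1 c ∧ ‖w.1‖ ≤ √(w.2 ^ 2 - 1)} /
      volume {w : EuclideanSpace ℝ (Fin n) × ℝ |
        w.2 ∈ Set.Icc 1 c ∧ ‖w.1‖ ≤ √(c ^ 2 - 1) / (c - 1) * (w.2 - 1)} =
      ENNReal.ofReal ((n + 1) / ((c ^ 2 - 1) ^ ((n : ℝ) / 2) * (c - 1)) *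
        ∫ ζ in (1 : ℝ)..c, (ζ ^ 2 - 1) ^ ((n : ℝ) / 2)) := by
  have hc1 : 0 < c - 1 := sub_pos.2 hc
  have hc2 : 0 < c ^ 2 - 1 := by nlinarith
  have hB0 : volume (Metric.ball (0 : EuclideanSpace ℝ (Fin n)) 1) ≠ 0 :=
    (Metric.measure_ball_pos _ _ one_pos).ne'
  have hB1 : volume (Metric.ball (0 : EuclideanSpace ℝ (Fin n)) 1) ≠ ⊤ :=
    measure_ball_lt_top.ne
  have hcone : ∫ z in (1 : ℝ)..c, (√(c ^ 2 - 1) / (c - 1) * (z - 1)) ^ n =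
      (c ^ 2 - 1) ^ ((n : ℝ) / 2) * (c - 1) / (n + 1) := by
    simp_rw [mul_pow]
    rw [intervalIntegral.integral_const_mul,
      intervalIntegral.integral_comp_sub_right (fun z => z ^ n), integral_pow, div_pow,
      sqrt_pow_eq_rpow_half hc2.le]
    simp only [sub_self, zero_pow n.succ_ne_zero, sub_zero]
    field_simp
    ring
  have hseg : ∫ z in (1 : ℝ)..c, √(z ^ 2 - 1) ^ n =
      ∫ z in (1 : ℝ)..c, (z ^ 2 - 1) ^ ((n : ℝ) / 2) := by
    apply intervalIntegral.integral_congr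
    intro z hz
    rw [Set.uIcc_of_le hc.le] at hz
    exact sqrt_pow_eq_rpow_half (by nlinarith [hz.1]) n
  have hpos : 0 < (c ^ 2 - 1) ^ ((n : ℝ) / 2) * (c - 1) / (n + 1) := by positivity
  rw [volume_solid_of_revolution_s7 n hc.le (f := fun z => √(z ^ 2 - 1)) (by fun_prop)
      fun z _ => Real.sqrt_nonneg _,
    volume_solid_of_revolution_s7 n hc.le (f := fun z => √(c ^ 2 - 1) / (c - 1) * (z - 1)) (by fun_prop)
      fun z hz =>
      mul_nonneg (by positivity) (sub_nonneg.2 hz.1),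
    ENNReal.mul_div_mul_right _ _ hB0 hB1, hcone, hseg, ← ENNReal.ofReal_div_of_pos hpos]
  congr 1
  rw [div_div_eq_mul_div]
  ring

theorem stmt_7 (n : ℕ) (hn : 1 ≤ n) (pb xb : EuclideanSpace ℝ (Fin n)) (zb : ℝ)
    (d q ζP : ℝ) (hd : d = zb - ⟪pb, xb⟫) (hq : q = 1 - ‖pb‖ ^ 2)
    (hq0 : q > 0) (hdq : d > Real.sqrt q) (hζP : ζP = d / Real.sqrt q)
    (S : Set (EuclideanSpace ℝ (Fin n) × ℝ))
    (hS : S = {w | 1 ≤ w.2 ∧ ‖w.1‖ ^ 2 ≤ w.2 ^ 2 - 1 ∧ w.2 ≤ zb + ⟪pb, w.1 - xb⟫})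
    (R : EuclideanSpace ℝ (Fin n) × ℝ)
    (hR : R = ((1 / Real.sqrt q) • pb, 1 / Real.sqrt q))
    (K : Set (EuclideanSpace ℝ (Fin n) × ℝ))
    (hK : K = convexHull ℝ (insert R {w ∈ S | w.2 = zb + ⟪pb, w.1 - xb⟫})) :
    volume S / volume K =
      ENNReal.ofReal ((n + 1) / ((ζP ^ 2 - 1) ^ ((n : ℝ) / 2) * (ζP - 1)) *
        ∫ ζ in (1 : ℝ)..ζP, (ζ ^ 2 - 1) ^ ((n : ℝ) / 2)) := by
  have hs : 0 < √q := Real.sqrt_pos.2 hq0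
  have hp : ‖pb‖ ^ 2 = 1 - √q ^ 2 := by rw [Real.sq_sqrt hq0.le]; linarith
  have hζ : 1 < ζP := by rw [hζP, one_lt_div hs]; exact hdq
  have hdζ : d = √q * ζP := by rw [hζP]; field_simp
  have hζ1 : 0 < ζP - 1 := sub_pos.2 hζ
  set L := lorentzBoost pb √q with hL
  have hinj : Function.Injective L := lorentzBoost_injective hs hp
  have hsurj : Function.Surjective L := LinearMap.surjective_of_injective hinj
  have hplane : ∀ w, zb + ⟪pb, (L w).1 - xb⟫ = (L w).2 - √q * w.2 + √q * ζP := by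
    intro w
    have := lorentzBoost_height hs hp w
    rw [inner_sub_right, ← this, ← hdζ, hd]
    ring
  have hS' : S = L '' {w | w.2 ∈ Set.Icc 1 ζP ∧ ‖w.1‖ ≤ √(w.2 ^ 2 - 1)} := by
    rw [← Set.preimage_eq_iff_eq_image ⟨hinj, hsurj⟩, hS]
    ext w
    have h1 : (L w).2 ≤ zb + ⟪pb, (L w).1 - xb⟫ ↔ w.2 ≤ ζP := by
      rw [hplane, ← mul_le_mul_iff_right₀ hs (b := w.2)]
      constructor <;> intro h <;> linarith
    have h2 := lorentzBoost_mem_hyperboloid hs hp w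
    simp only [Set.mem_preimage, Set.mem_ofPred_eq, Set.mem_Icc, h1]
    rw [← and_assoc, h2]
    constructor
    · rintro ⟨⟨h3, h4⟩, h5⟩
      exact ⟨⟨h3, h5⟩, Real.le_sqrt_of_sq_le h4⟩
    · rintro ⟨⟨h3, h5⟩, h4⟩
      exact ⟨⟨h3, (Real.le_sqrt (norm_nonneg _) (by nlinarith)).1 h4⟩, h5⟩
  have hbase : {w ∈ S | w.2 = zb + ⟪pb, w.1 - xb⟫} =
      L '' {w | ‖w.1‖ ≤ √(ζP ^ 2 - 1) / (ζP - 1) * (ζP - 1) ∧ w.2 = ζP} := by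
    rw [← Set.preimage_eq_iff_eq_image ⟨hinj, hsurj⟩, hS']
    ext w
    have h1 : (L w).2 = zb + ⟪pb, (L w).1 - xb⟫ ↔ w.2 = ζP := by
      rw [hplane, ← mul_right_inj' hs.ne' (b := w.2)]
      constructor <;> intro h <;> linarith
    simp only [Set.mem_preimage, Set.mem_ofPred_eq, h1, hinj.mem_set_image,
      div_mul_cancel₀ _ hζ1.ne']
    constructor
    · rintro ⟨⟨_, h⟩, rfl⟩
      exact ⟨h, rfl⟩
    · rintro ⟨h, rfl⟩
      exact ⟨⟨⟨hζ.le, le_rfl⟩, h⟩, rfl⟩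
  have hR' : R = L (0, 1) := by
    rw [hR]
    simp [hL, lorentzBoost]
  have hK' : K = L '' {w | w.2 ∈ Set.Icc 1 ζP ∧
      ‖w.1‖ ≤ √(ζP ^ 2 - 1) / (ζP - 1) * (w.2 - 1)} := by
    rw [hK, hbase, hR', ← Set.image_insert_eq, ← LinearMap.image_convexHull,
      convexHull_insert_disk hζ]
  have hdet : LinearMap.det L ≠ 0 :=
    (LinearEquiv.isUnit_det' (LinearEquiv.ofBijective L ⟨hinj, hsurj⟩)).ne_zero
  have : (volume : Measure (EuclideanSpace ℝ (Fin n) × ℝ)).IsAddHaarMeasure :=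
    Measure.prod.instIsAddHaarMeasure volume volume
  rw [hS', hK', Measure.addHaar_image_linearMap, Measure.addHaar_image_linearMap,
    ENNReal.mul_div_mul_left _ _ (by simpa using hdet) ENNReal.ofReal_ne_top,
    volume_ratio_upright n hζ]
end

section
/- Let n ≥ 1, let a₁, …, a_{n+1} > 0, and set h(x,z) = −Σ_{i=1}^n xᵢ²/aᵢ² + z²/a_{n+1}². Let f : ℝⁿ → ℝ be twice continuously differentiable with f(x) > a_{n+1}√(1 + Σ_{i=1}^n xᵢ²/aᵢ²) for all x (so the graph of f lies inside the upper sheet of h = 1). Assume that for every x̄ ∈ ℝⁿ, writing p̄ᵢ = ∂f/∂xᵢ(x̄) and z̄ = f(x̄), one has a_{n+1}² − Σ_{i=1}^n aᵢ²p̄ᵢ² > 0 and z̄ − Σ_{i=1}^n p̄ᵢx̄ᵢ ≥ √(a_{n+1}² − Σ_{i=1}^n aᵢ²p̄ᵢ²), and that there is a constant V > 0 such that the (n+1)-dimensional Lebesgue measure of {(x,z) ∈ ℝⁿ × ℝ : a_{n+1}√(1 + Σ_{i=1}^n xᵢ²/aᵢ²) ≤ z ≤ z̄ + Σ_{i=1}^n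 p̄ᵢ(xᵢ − x̄ᵢ)} equals V for all x̄. Then there is k > 1 with V = a₁⋯a_{n+1} · (π^{n/2} / Γ(n/2 + 1)) · ∫₁^{k} (ζ² − 1)^{n/2} dζ and f(x) = a_{n+1}√(k² + Σ_{i=1}^n xᵢ²/aᵢ²) for all x, i.e. the graph of f is the upper sheet of the hyperboloid h(x,z) = k². -/
open MeasureTheory

/-- The Hessian `D'` of a solution of the Clairaut equation kills `y - (k / √(1 - ‖D y‖²)) • D y`. -/
theorem clairaut_hessian_apply_eq_zero {E : Type*} [NormedAddCommGroup E] [InnerProductSpace ℝ E]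
    {F : E → ℝ} {D : E → E} {k : ℝ}
    (hF : ∀ y, HasFDerivAt F (innerSL ℝ (D y)) y)
    (hlt : ∀ y, ‖D y‖ < 1)
    (heq : ∀ y, F y - inner ℝ (D y) y = k * √(1 - ‖D y‖ ^ 2))
    {y : E} {D' : E →L[ℝ] E} (hD : HasFDerivAt D D' y) :
    D' (y - (k / √(1 - ‖D y‖ ^ 2)) • D y) = 0 := by
  have hsymm : ∀ u v, inner ℝ (D' u) v = inner ℝ (D' v) u := by
    have h2 : HasFDerivAt (fun y => innerSL ℝ (D y))
        ((innerSL ℝ : E →L[ℝ] E →L[ℝ] ℝ).comp D') y :=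
      (innerSL ℝ : E →L[ℝ] E →L[ℝ] ℝ).hasFDerivAt.comp y hD
    exact fun u v => second_derivative_symmetric hF h2 u v
  have hpos : 0 < 1 - ‖D y‖ ^ 2 := by nlinarith [hlt y, norm_nonneg (D y)]
  have hkey : ∀ v, inner ℝ (D' v) (y - (k / √(1 - ‖D y‖ ^ 2)) • D y) = 0 := by
    intro v
    have h1 := (hF y).sub (hD.inner ℝ (hasFDerivAt_id y))
    have h2 := ((hD.norm_sq.const_sub 1).sqrt hpos.ne').const_mul k
    have h3 : (fun y => F y - inner ℝ (D y) y) = fun y => k * √(1 - ‖D y‖ ^ 2) := funext heq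
    have h4 := congrArg (fun T => T v) (h1.unique (h3 ▸ h2))
    simp only [fderivInnerCLM_apply, sub_apply, ContinuousLinearMap.comp_apply,
      ContinuousLinearMap.prod_apply, innerSL_apply_apply, id, ContinuousLinearMap.id_apply,
      smul_apply, neg_apply, smul_eq_mul, nsmul_eq_mul] at h4
    have hs : √(1 - ‖D y‖ ^ 2) ≠ 0 := (Real.sqrt_pos.2 hpos).ne'
    rw [inner_sub_right, inner_smul_right]
    rw [real_inner_comm (D' v) (D y)] at h4
    field_simp at h4 ⊢
    simp at h4
    linarith
  refine ext_inner_right ℝ fun v => ?_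
  rw [hsymm, hkey, inner_zero_left]

/-- The gradient of a solution of the Clairaut equation is constant along characteristic rays. -/
theorem clairaut_gradient_ray {E : Type*} [NormedAddCommGroup E] [InnerProductSpace ℝ E]
    [FiniteDimensional ℝ E] {F : E → ℝ} {D : E → E} {k : ℝ}
    (hD : ContDiff ℝ 1 D) (hF : ∀ y, HasFDerivAt F (innerSL ℝ (D y)) y)
    (hlt : ∀ y, ‖D y‖ < 1)
    (heq : ∀ y, F y - inner ℝ (D y) y = k * √(1 - ‖D y‖ ^ 2))
    (y : E) {s : ℝ} (hs : 1 ≤ s) {p : E} (hp : p = (k / √(1 - ‖D y‖ ^ 2)) • D y) :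
    D (p + s • (y - p)) = D y := by
  have hDd : ∀ z, HasFDerivAt D (fderiv ℝ D z) z :=
    fun z => (hD.differentiable one_ne_zero z).hasFDerivAt
  set r : ℝ → E := fun t => p + t • (y - p) with hr
  have hrc : Continuous r := by fun_prop
  have hr1 : r 1 = y := by simp [hr]
  have hrd : ∀ t, HasDerivAt r (y - p) t := fun t => by
    have h := ((hasDerivAt_id t).smul_const (y - p)).const_add p
    rwa [one_smul] at h
  set P : E → E := fun q => (k / √(1 - ‖q‖ ^ 2)) • q with hP
  have hker : ∀ z, fderiv ℝ D z (z - P (D z)) = 0 := fun z =>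
    clairaut_hessian_apply_eq_zero hF hlt heq (hDd z)
  obtain ⟨C, hC⟩ := (isCompact_Icc (a := (1 : ℝ)) (b := s)).exists_bound_of_continuousOn
    (f := fun t => fderiv ℝ D (r t)) (((hD.continuous_fderiv one_ne_zero).comp hrc).continuousOn)
  obtain ⟨t₀, -, ht₀⟩ := (isCompact_Icc (a := (1 : ℝ)) (b := s)).exists_isMaxOn
    ⟨1, le_refl _, hs⟩ ((hD.continuous.comp hrc).norm.continuousOn)
  set ρ := ‖D (r t₀)‖
  have hmem : ∀ t ∈ Set.Icc 1 s, D (r t) ∈ Metric.closedBall (0 : E) ρ := fun t ht => by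
    simpa using ht₀ ht
  have hPc : ContDiffOn ℝ 1 P (Metric.closedBall (0 : E) ρ) := by
    intro q hq
    have hq' : 0 < 1 - ‖q‖ ^ 2 := by
      have : ‖q‖ < 1 := lt_of_le_of_lt (by simpa using hq) (hlt (r t₀))
      nlinarith [norm_nonneg q]
    have h1 : ContDiffAt ℝ 1 (fun q : E => √(1 - ‖q‖ ^ 2)) q :=
      (contDiffAt_const.sub (contDiff_norm_sq ℝ).contDiffAt).sqrt hq'.ne'
    exact ((contDiffAt_const.div h1 (Real.sqrt_pos.2 hq').ne').smul contDiffAt_id).contDiffWithinAt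
  obtain ⟨K, hK⟩ := hPc.exists_lipschitzOnWith one_ne_zero (convex_closedBall _ _)
    (isCompact_closedBall _ _)
  have hpy : p = P (D y) := hp
  have hzero := eq_zero_of_abs_deriv_le_mul_abs_self_of_eq_zero_right
    (f := fun t => D (r t) - D y) (f' := fun t => fderiv ℝ D (r t) (y - p)) (K := C * K)
    (a := 1) (b := s) (by
      exact ((hD.continuous.comp hrc).sub continuous_const).continuousOn)
    (fun t _ => (((hDd (r t)).comp_hasDerivAt t (hrd t)).sub_const (D y)).hasDerivWithinAt)
    (by simp [hr1]) (by
      intro t ht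
      have ht' : t ∈ Set.Icc 1 s := ⟨ht.1, ht.2.le⟩
      have ht0 : 0 < t := lt_of_lt_of_le one_pos ht.1
      have h1 : y - p = t⁻¹ • ((r t - P (D (r t))) + (P (D (r t)) - P (D y))) := by
        rw [sub_add_sub_cancel, ← hpy, hr]
        simp [smul_smul, ht0.ne']
      have h2 : ‖P (D (r t)) - P (D y)‖ ≤ K * ‖D (r t) - D y‖ :=
        hK.norm_sub_le (hmem t ht') (by
          have := hmem 1 ⟨le_refl _, hs⟩
          rwa [hr1] at this)
      rw [h1, map_smul, map_add, hker, zero_add, norm_smul, norm_inv, Real.norm_eq_abs,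
        abs_of_pos ht0]
      have hC0 : 0 ≤ C := (norm_nonneg _).trans (hC t ht')
      calc t⁻¹ * ‖fderiv ℝ D (r t) (P (D (r t)) - P (D y))‖
          ≤ 1 * ‖fderiv ℝ D (r t) (P (D (r t)) - P (D y))‖ := by
            gcongr
            exact inv_le_one_of_one_le₀ ht.1
        _ ≤ C * (K * ‖D (r t) - D y‖) := by
            rw [one_mul]
            exact (ContinuousLinearMap.le_opNorm _ _).trans
              (mul_le_mul (hC t ht') h2 (norm_nonneg _) hC0)
        _ = C * K * ‖D (r t) - D y‖ := by ring)
  exact sub_eq_zero.1 (hzero s ⟨hs, le_refl _⟩)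

/-- A solution of the Clairaut equation lying above the cone is a sheet of a hyperboloid. -/
theorem clairaut_eq_hyperboloid {E : Type*} [NormedAddCommGroup E] [InnerProductSpace ℝ E]
    [FiniteDimensional ℝ E] {F : E → ℝ} {D : E → E} {k : ℝ} (hk : 0 < k)
    (hD : ContDiff ℝ 1 D) (hF : ∀ y, HasFDerivAt F (innerSL ℝ (D y)) y)
    (hlt : ∀ y, ‖D y‖ < 1)
    (heq : ∀ y, F y - inner ℝ (D y) y = k * √(1 - ‖D y‖ ^ 2))
    (hcone : ∀ y, ‖y‖ ≤ F y) (y : E) :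
    F y = √(k ^ 2 + ‖y‖ ^ 2) := by
  obtain ⟨p, hp⟩ : ∃ p, p = (k / √(1 - ‖D y‖ ^ 2)) • D y := ⟨_, rfl⟩
  have hpos : 0 < 1 - ‖D y‖ ^ 2 := by nlinarith [hlt y, norm_nonneg (D y)]
  set σ := √(1 - ‖D y‖ ^ 2) with hσ
  have hσ0 : 0 < σ := Real.sqrt_pos.2 hpos
  have hσ2 : σ ^ 2 = 1 - ‖D y‖ ^ 2 := Real.sq_sqrt hpos.le
  have hyp : y = p := by
    by_contra hne
    have hw : 0 < ‖y - p‖ := norm_pos_iff.2 (sub_ne_zero.2 hne)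
    have hbound : ∀ s : ℝ, 1 ≤ s → (1 - ‖D y‖) * (s * ‖y - p‖ - ‖p‖) ≤ k * σ := by
      intro s hs
      have h1 := heq (p + s • (y - p))
      rw [clairaut_gradient_ray hD hF hlt heq y hs hp] at h1
      have h2 := hcone (p + s • (y - p))
      have h3 := real_inner_le_norm (D y) (p + s • (y - p))
      have h4 : s * ‖y - p‖ - ‖p‖ ≤ ‖p + s • (y - p)‖ := by
        have := norm_sub_norm_le (s • (y - p)) (-p)
        rw [norm_smul, norm_neg, Real.norm_eq_abs, abs_of_pos (by linarith), sub_neg_eq_add,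
          add_comm (s • (y - p))] at this
        exact this
      nlinarith [hlt y]
    have hq : 0 < 1 - ‖D y‖ := by linarith [hlt y]
    set M := (k * σ / (1 - ‖D y‖) + ‖p‖ + 1) / ‖y - p‖ with hM
    have h5 := hbound (max 1 M) (le_max_left _ _)
    have h6 : M * ‖y - p‖ ≤ max 1 M * ‖y - p‖ := by gcongr; exact le_max_right _ _
    have h7 : M * ‖y - p‖ = k * σ / (1 - ‖D y‖) + ‖p‖ + 1 := by rw [hM]; field_simp
    have h8 : (1 - ‖D y‖) * (k * σ / (1 - ‖D y‖) + 1) = k * σ + (1 - ‖D y‖) := by field_simp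
    nlinarith
  have hin : inner ℝ (D y) y = k / σ * ‖D y‖ ^ 2 := by
    nth_rw 2 [hyp]
    rw [hp, inner_smul_right, real_inner_self_eq_norm_sq]
  have hny : ‖y‖ = k / σ * ‖D y‖ := by
    nth_rw 1 [hyp]
    rw [hp, norm_smul, Real.norm_eq_abs, abs_of_pos (by positivity)]
  have hFy : F y = k / σ := by
    have := heq y
    rw [hin] at this
    have h9 : k * σ = k / σ * σ ^ 2 := by field_simp
    rw [← hσ, h9, hσ2] at this
    linarith
  rw [hFy, hny]
  symm
  rw [Real.sqrt_eq_iff_mul_self_eq (by positivity) (by positivity)]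
  have h10 : k ^ 2 = (k / σ) ^ 2 * σ ^ 2 := by field_simp
  rw [h10, hσ2]
  ring

/-- The Lorentz involution exchanging `(0, 1)` and the unit normal `(γ • q, γ)`, where
`γ = 1 / √(1 - ‖q‖²)`. -/
noncomputable def lorentzInvolution {E : Type*} [NormedAddCommGroup E] [InnerProductSpace ℝ E]
    (q : E) (γ : ℝ) : E × ℝ →ₗ[ℝ] E × ℝ :=
  LinearMap.prod
    (-LinearMap.fst ℝ E ℝ + (γ • (LinearMap.snd ℝ E ℝ -
      (γ / (1 + γ)) • (innerₗ E q).comp (LinearMap.fst ℝ E ℝ))).smulRight q)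
    (γ • (LinearMap.snd ℝ E ℝ - (innerₗ E q).comp (LinearMap.fst ℝ E ℝ)))

theorem lorentzInvolution_apply {E : Type*} [NormedAddCommGroup E] [InnerProductSpace ℝ E]
    (q : E) (γ : ℝ) (w : E × ℝ) : lorentzInvolution q γ w =
      (-w.1 + (γ * (w.2 - γ / (1 + γ) * inner ℝ q w.1)) • q, γ * (w.2 - inner ℝ q w.1)) := by
  simp [lorentzInvolution]

theorem lorentzInvolution_comp_self {E : Type*} [NormedAddCommGroup E] [InnerProductSpace ℝ E]
    {q : E} {γ : ℝ} (hγ : 0 < γ) (hq : γ ^ 2 * (1 - ‖q‖ ^ 2) = 1) :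
    lorentzInvolution q γ ∘ₗ lorentzInvolution q γ = LinearMap.id := by
  have h1 : 1 + γ ≠ 0 := by positivity
  have hq' : ‖q‖ ^ 2 = 1 - 1 / γ ^ 2 := by field_simp; linarith
  refine LinearMap.ext fun w => Prod.ext ?_ ?_
  · simp only [LinearMap.comp_apply, lorentzInvolution_apply, LinearMap.id_apply, inner_add_right,
      inner_neg_right, inner_smul_right, real_inner_self_eq_norm_sq, hq']
    rw [neg_add, neg_neg, add_assoc, ← neg_smul, ← add_smul]
    convert add_zero w.1
    convert zero_smul ℝ q
    field_simp
    ring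
  · simp only [LinearMap.comp_apply, lorentzInvolution_apply, LinearMap.id_apply, inner_add_right,
      inner_neg_right, inner_smul_right, real_inner_self_eq_norm_sq, hq']
    field_simp
    ring

theorem lorentzInvolution_minkowski {E : Type*} [NormedAddCommGroup E] [InnerProductSpace ℝ E]
    {q : E} {γ : ℝ} (hγ : 0 < γ) (hq : γ ^ 2 * (1 - ‖q‖ ^ 2) = 1) (w : E × ℝ) :
    (lorentzInvolution q γ w).2 ^ 2 - ‖(lorentzInvolution q γ w).1‖ ^ 2 = w.2 ^ 2 - ‖w.1‖ ^ 2 := by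
  have h1 : 1 + γ ≠ 0 := by positivity
  have hq' : ‖q‖ ^ 2 = 1 - 1 / γ ^ 2 := by field_simp; linarith
  rw [lorentzInvolution_apply]
  simp only
  rw [norm_add_sq_real, norm_neg, norm_smul, mul_pow, mul_pow ‖_‖ ‖q‖, hq', inner_neg_left, inner_smul_right,
    Real.norm_eq_abs, sq_abs, real_inner_comm]
  field_simp
  ring

/-- Cutting the solid upper sheet by a hyperplane is Lorentz equivalent to cutting it by a
horizontal hyperplane. -/
theorem lorentzInvolution_preimage_cap {E : Type*} [NormedAddCommGroup E] [InnerProductSpace ℝ E]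
    {q : E} (hq : ‖q‖ < 1) (κ : ℝ) :
    lorentzInvolution q (√(1 - ‖q‖ ^ 2))⁻¹ ⁻¹' {w | √(1 + ‖w.1‖ ^ 2) ≤ w.2 ∧ w.2 ≤ κ} =
      {w | √(1 + ‖w.1‖ ^ 2) ≤ w.2 ∧ w.2 ≤ inner ℝ q w.1 + κ * √(1 - ‖q‖ ^ 2)} := by
  have hpos : 0 < 1 - ‖q‖ ^ 2 := by nlinarith [norm_nonneg q]
  set σ := √(1 - ‖q‖ ^ 2) with hσ
  have hσ0 : 0 < σ := Real.sqrt_pos.2 hpos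
  have hγ : 0 < σ⁻¹ := by positivity
  have hσ2 : σ ^ 2 = 1 - ‖q‖ ^ 2 := Real.sq_sqrt hpos.le
  have hγq : σ⁻¹ ^ 2 * (1 - ‖q‖ ^ 2) = 1 := by rw [← hσ2]; field_simp
  have hsheet : ∀ w : E × ℝ, √(1 + ‖w.1‖ ^ 2) ≤ w.2 ↔ 0 ≤ w.2 ∧ 1 ≤ w.2 ^ 2 - ‖w.1‖ ^ 2 := by
    intro w
    rw [Real.sqrt_le_iff, le_sub_iff_add_le]
  have hup : ∀ w : E × ℝ, 0 ≤ w.2 ∧ 1 ≤ w.2 ^ 2 - ‖w.1‖ ^ 2 →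
      0 ≤ (lorentzInvolution q σ⁻¹ w).2 := by
    rintro w ⟨h0, h1⟩
    rw [lorentzInvolution_apply]
    refine mul_nonneg hγ.le (sub_nonneg.2 ?_)
    have h2 : ‖w.1‖ ≤ w.2 := abs_le_of_sq_le_sq' (by linarith) h0 |>.2
    calc inner ℝ q w.1 ≤ ‖q‖ * ‖w.1‖ := real_inner_le_norm _ _
      _ ≤ 1 * ‖w.1‖ := by gcongr
      _ ≤ w.2 := by rwa [one_mul]
  have hinv : ∀ w, lorentzInvolution q σ⁻¹ (lorentzInvolution q σ⁻¹ w) = w := fun w =>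
    congrArg (fun T => T w) (lorentzInvolution_comp_self hγ hγq)
  ext w
  simp only [Set.mem_preimage, Set.mem_ofPred_eq, hsheet]
  refine and_congr ⟨fun h => ?_, fun h => ⟨hup w h, ?_⟩⟩ ?_
  · have h' := hup _ h
    rw [hinv] at h'
    exact ⟨h', by rw [← lorentzInvolution_minkowski hγ hγq]; exact h.2⟩
  · rw [lorentzInvolution_minkowski hγ hγq]; exact h.2
  · rw [lorentzInvolution_apply]
    simp only
    rw [inv_mul_le_iff₀ hσ0, sub_le_iff_le_add, mul_comm σ κ, add_comm]

theorem isAddHaarMeasure_volume_euclideanSpace_prod (n : ℕ) :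
    (volume : Measure (EuclideanSpace ℝ (Fin n) × ℝ)).IsAddHaarMeasure :=
  inferInstanceAs (Measure.prod volume volume).IsAddHaarMeasure

theorem volume_oblique_cap {n : ℕ} {q : EuclideanSpace ℝ (Fin n)} (hq : ‖q‖ < 1) (κ : ℝ) :
    volume {w : EuclideanSpace ℝ (Fin n) × ℝ | √(1 + ‖w.1‖ ^ 2) ≤ w.2 ∧
      w.2 ≤ inner ℝ q w.1 + κ * √(1 - ‖q‖ ^ 2)} =
    volume {w : EuclideanSpace ℝ (Fin n) × ℝ | √(1 + ‖w.1‖ ^ 2) ≤ w.2 ∧ w.2 ≤ κ} := by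
  have hpos : 0 < 1 - ‖q‖ ^ 2 := by nlinarith [norm_nonneg q]
  have hγq : (√(1 - ‖q‖ ^ 2))⁻¹ ^ 2 * (1 - ‖q‖ ^ 2) = 1 := by
    rw [inv_pow, Real.sq_sqrt hpos.le, inv_mul_cancel₀ hpos.ne']
  have hdet := congrArg LinearMap.det
    (lorentzInvolution_comp_self (inv_pos.2 (Real.sqrt_pos.2 hpos)) hγq)
  rw [LinearMap.det_comp, LinearMap.det_id] at hdet
  have habs : |LinearMap.det (lorentzInvolution q (√(1 - ‖q‖ ^ 2))⁻¹)| = 1 := by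
    rcases mul_self_eq_one_iff.1 hdet with h | h <;> simp [h]
  have := isAddHaarMeasure_volume_euclideanSpace_prod n
  rw [← lorentzInvolution_preimage_cap hq, Measure.addHaar_preimage_linearMap volume
    (fun h => by simp [h] at habs), abs_inv, habs]
  simp

theorem volume_horizontal_cap {n : ℕ} (hn : 1 ≤ n) {κ : ℝ} (hκ : 1 ≤ κ) :
    volume {w : EuclideanSpace ℝ (Fin n) × ℝ | √(1 + ‖w.1‖ ^ 2) ≤ w.2 ∧ w.2 ≤ κ} =
      ENNReal.ofReal ((Real.pi ^ ((n : ℝ) / 2) / Real.Gamma ((n : ℝ) / 2 + 1)) *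
        (∫ ζ in (1 : ℝ)..κ, (ζ ^ 2 - 1) ^ ((n : ℝ) / 2))) := by
  have : Nonempty (Fin n) := ⟨⟨0, hn⟩⟩
  set c := Real.pi ^ ((n : ℝ) / 2) / Real.Gamma ((n : ℝ) / 2 + 1) with hc
  have hc0 : 0 ≤ c := by
    have : 0 < Real.Gamma ((n : ℝ) / 2 + 1) := Real.Gamma_pos_of_pos (by positivity)
    positivity
  have hmeas : MeasurableSet
      {w : EuclideanSpace ℝ (Fin n) × ℝ | √(1 + ‖w.1‖ ^ 2) ≤ w.2 ∧ w.2 ≤ κ} := by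
    apply IsClosed.measurableSet
    exact (isClosed_le (f := fun w : EuclideanSpace ℝ (Fin n) × ℝ => √(1 + ‖w.1‖ ^ 2))
      (by fun_prop) continuous_snd).inter (isClosed_le continuous_snd continuous_const)
  have hslice : ∀ ζ : ℝ, volume ((fun y : EuclideanSpace ℝ (Fin n) => (y, ζ)) ⁻¹'
      {w : EuclideanSpace ℝ (Fin n) × ℝ | √(1 + ‖w.1‖ ^ 2) ≤ w.2 ∧ w.2 ≤ κ}) =
      (Set.Icc 1 κ).indicator (fun ζ => ENNReal.ofReal (c * (ζ ^ 2 - 1) ^ ((n : ℝ) / 2))) ζ := by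
    intro ζ
    by_cases hζ : ζ ∈ Set.Icc 1 κ
    · have h0 : 0 ≤ ζ ^ 2 - 1 := by nlinarith [hζ.1]
      have hball : (fun y : EuclideanSpace ℝ (Fin n) => (y, ζ)) ⁻¹'
          {w : EuclideanSpace ℝ (Fin n) × ℝ | √(1 + ‖w.1‖ ^ 2) ≤ w.2 ∧ w.2 ≤ κ} =
          Metric.closedBall 0 √(ζ ^ 2 - 1) := by
        ext y
        simp only [Set.mem_preimage, Set.mem_ofPred_eq, hζ.2, and_true, mem_closedBall_zero_iff]
        rw [Real.sqrt_le_left (by linarith [hζ.1]), Real.le_sqrt (norm_nonneg y) h0]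
        constructor <;> intro h <;> linarith
      rw [hball, EuclideanSpace.volume_closedBall, Set.indicator_of_mem hζ, Fintype.card_fin,
        ← ENNReal.ofReal_pow (Real.sqrt_nonneg _), ← ENNReal.ofReal_mul (by positivity), mul_comm]
      have hpow : ∀ x : ℝ, 0 ≤ x → √x ^ n = x ^ ((n : ℝ) / 2) := fun x hx => by
        rw [Real.sqrt_eq_rpow, ← Real.rpow_natCast, ← Real.rpow_mul hx]
        congr 1
        ring
      rw [hpow _ h0, hpow _ Real.pi_pos.le]
    · rw [Set.indicator_of_notMem hζ]
      convert measure_empty (μ := (volume : Measure (EuclideanSpace ℝ (Fin n))))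
      ext y
      simp only [Set.mem_preimage, Set.mem_ofPred_eq, Set.mem_empty_iff_false, iff_false]
      rintro ⟨h1, h2⟩
      refine hζ ⟨le_trans ?_ h1, h2⟩
      exact Real.one_le_sqrt.2 (by nlinarith [norm_nonneg y])
  have hcont : Continuous fun ζ : ℝ => c * (ζ ^ 2 - 1) ^ ((n : ℝ) / 2) :=
    continuous_const.mul (Continuous.rpow_const (by fun_prop) fun _ => Or.inr (by positivity))
  rw [Measure.volume_eq_prod, Measure.prod_apply_symm hmeas]
  simp_rw [hslice]
  rw [lintegral_indicator measurableSet_Icc, ← ofReal_integral_eq_lintegral_ofReal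
    (hcont.integrableOn_Icc), ← intervalIntegral.integral_const_mul,
    intervalIntegral.integral_of_le hκ, integral_Icc_eq_integral_Ioc]
  filter_upwards [ae_restrict_mem measurableSet_Icc] with ζ hζ
  have h0 : 0 ≤ ζ ^ 2 - 1 := by nlinarith [hζ.1]
  exact mul_nonneg hc0 (Real.rpow_nonneg h0 _)

theorem strictMonoOn_integral_sq_sub_one_rpow (r : ℝ) (hr : 0 ≤ r) :
    StrictMonoOn (fun κ : ℝ => ∫ ζ in (1 : ℝ)..κ, (ζ ^ 2 - 1) ^ r) (Set.Ici 1) := by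
  have hcont : Continuous fun ζ : ℝ => (ζ ^ 2 - 1) ^ r :=
    Continuous.rpow_const (by fun_prop) fun _ => Or.inr hr
  intro s hs t _ hst
  have h := intervalIntegral.integral_add_adjacent_intervals
    (hcont.intervalIntegrable (μ := volume) 1 s) (hcont.intervalIntegrable s t)
  have hpos := intervalIntegral.intervalIntegral_pos_of_pos_on
    (hcont.intervalIntegrable (μ := volume) s t) (fun x hx => Real.rpow_pos_of_pos (by
      have h1 : 1 < x := lt_of_le_of_lt hs hx.1
      nlinarith) r) hst
  simp only
  linarith

/-- The linear map `(x, z) ↦ (xᵢ / aᵢ, z / b)`. -/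
noncomputable def axisScaling {n : ℕ} (a : Fin n → ℝ) (b : ℝ) :
    EuclideanSpace ℝ (Fin n) × ℝ →ₗ[ℝ] EuclideanSpace ℝ (Fin n) × ℝ :=
  LinearMap.prodMap
    (Matrix.toEuclideanLin (Matrix.diagonal fun i => (a i)⁻¹)) (b⁻¹ • LinearMap.id)

theorem axisScaling_fst {n : ℕ} (a : Fin n → ℝ) (b : ℝ) (w : EuclideanSpace ℝ (Fin n) × ℝ)
    (i : Fin n) : (axisScaling a b w).1 i = w.1 i / a i := by
  simp [axisScaling, Matrix.toLpLin_apply, Matrix.mulVec_diagonal, div_eq_inv_mul]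

theorem axisScaling_snd {n : ℕ} (a : Fin n → ℝ) (b : ℝ) (w : EuclideanSpace ℝ (Fin n) × ℝ) :
    (axisScaling a b w).2 = w.2 / b := by
  simp [axisScaling, div_eq_inv_mul]

theorem volume_preimage_axisScaling {n : ℕ} {a : Fin n → ℝ} {b : ℝ} (ha : ∀ i, 0 < a i)
    (hb : 0 < b) (s : Set (EuclideanSpace ℝ (Fin n) × ℝ)) :
    volume (axisScaling a b ⁻¹' s) = ENNReal.ofReal ((∏ i, a i) * b) * volume s := by
  have hdet : LinearMap.det (axisScaling a b) = ((∏ i, a i) * b)⁻¹ := by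
    rw [axisScaling, LinearMap.det_prodMap,
      Matrix.toEuclideanLin_eq_toLin_orthonormal, LinearMap.det_toLin, Matrix.det_diagonal,
      LinearMap.det_smul, LinearMap.det_id, mul_inv, Finset.prod_inv_distrib]
    simp
  have hpos : 0 < (∏ i, a i) * b := mul_pos (Finset.prod_pos fun i _ => ha i) hb
  have := isAddHaarMeasure_volume_euclideanSpace_prod n
  rw [Measure.addHaar_preimage_linearMap volume (by rw [hdet]; positivity), hdet, inv_inv,
    abs_of_pos hpos]

/-- In normalized coordinates every region cut off by a tangent hyperplane is a cap of height
`κ = (f - ∇f · x) / √(b² - ∑ aᵢ² (∂ᵢf)²)`. -/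
theorem volume_cut {n : ℕ} (hn : 1 ≤ n) {a : Fin n → ℝ} {b : ℝ} (ha : ∀ i, 0 < a i) (hb : 0 < b)
    {p q : EuclideanSpace ℝ (Fin n)} (hpq : ∀ i, q i = a i * p i / b) (hq : ‖q‖ < 1)
    {κ : ℝ} (hκ : 1 ≤ κ) :
    volume {w : EuclideanSpace ℝ (Fin n) × ℝ |
        b * √(1 + ∑ i, (w.1 i) ^ 2 / (a i) ^ 2) ≤ w.2 ∧
        w.2 ≤ b * (κ * √(1 - ‖q‖ ^ 2)) + ∑ i, p i * w.1 i} =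
      ENNReal.ofReal ((∏ i, a i) * b *
        (Real.pi ^ ((n : ℝ) / 2) / Real.Gamma ((n : ℝ) / 2 + 1)) *
        (∫ ζ in (1 : ℝ)..κ, (ζ ^ 2 - 1) ^ ((n : ℝ) / 2))) := by
  have hpos : 0 ≤ (∏ i, a i) * b := (mul_pos (Finset.prod_pos fun i _ => ha i) hb).le
  rw [mul_assoc ((∏ i, a i) * b), ENNReal.ofReal_mul hpos, ← volume_horizontal_cap hn hκ,
    ← volume_oblique_cap hq, ← volume_preimage_axisScaling ha hb]
  congr 1
  ext w
  simp only [Set.mem_preimage, Set.mem_ofPred_eq, axisScaling_snd]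
  have h1 : ‖(axisScaling a b w).1‖ ^ 2 = ∑ i, (w.1 i) ^ 2 / (a i) ^ 2 := by
    rw [EuclideanSpace.real_norm_sq_eq]
    exact Finset.sum_congr rfl fun i _ => by rw [axisScaling_fst, div_pow]
  have h2 : inner ℝ q (axisScaling a b w).1 = (∑ i, p i * w.1 i) / b := by
    rw [PiLp.inner_apply, Finset.sum_div]
    refine Finset.sum_congr rfl fun i _ => ?_
    have := (ha i).ne'
    rw [axisScaling_fst, hpq, RCLike.inner_apply, conj_trivial]
    field_simp
  rw [h1, h2, le_div_iff₀ hb, div_le_iff₀ hb, mul_comm b]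
  refine and_congr_right fun _ => ?_
  rw [add_mul, div_mul_cancel₀ _ hb.ne', add_comm, mul_comm b]

theorem stmt_9 (n : ℕ) (hn : 1 ≤ n) (a : Fin n → ℝ) (b : ℝ)
    (ha : ∀ i, a i > 0) (hb : b > 0)
    (f : EuclideanSpace ℝ (Fin n) → ℝ) (hf : ContDiff ℝ 2 f)
    (hfin : ∀ x : EuclideanSpace ℝ (Fin n),
      f x > b * Real.sqrt (1 + ∑ i, (x i) ^ 2 / (a i) ^ 2))
    (hslope : ∀ xb : EuclideanSpace ℝ (Fin n),
      b ^ 2 - ∑ i, (a i) ^ 2 * (fderiv ℝ f xb (EuclideanSpace.single i 1)) ^ 2 > 0 ∧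
      f xb - ∑ i, (fderiv ℝ f xb (EuclideanSpace.single i 1)) * xb i ≥
        Real.sqrt (b ^ 2 - ∑ i, (a i) ^ 2 * (fderiv ℝ f xb (EuclideanSpace.single i 1)) ^ 2))
    (V : ℝ) (hV : V > 0)
    (hvol : ∀ xb : EuclideanSpace ℝ (Fin n),
      volume {w : EuclideanSpace ℝ (Fin n) × ℝ |
          b * Real.sqrt (1 + ∑ i, (w.1 i) ^ 2 / (a i) ^ 2) ≤ w.2 ∧
          w.2 ≤ f xb + ∑ i, (fderiv ℝ f xb (EuclideanSpace.single i 1)) * (w.1 i - xb i)} =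
        ENNReal.ofReal V) :
    ∃ k : ℝ, 1 < k ∧
      V = (∏ i, a i) * b *
        (Real.pi ^ ((n : ℝ) / 2) / Real.Gamma ((n : ℝ) / 2 + 1)) *
        (∫ ζ in (1 : ℝ)..k, (ζ ^ 2 - 1) ^ ((n : ℝ) / 2)) ∧
      ∀ x : EuclideanSpace ℝ (Fin n),
        f x = b * Real.sqrt (k ^ 2 + ∑ i, (x i) ^ 2 / (a i) ^ 2) := by
  set A : EuclideanSpace ℝ (Fin n) →L[ℝ] EuclideanSpace ℝ (Fin n) :=
    (Matrix.toEuclideanLin (Matrix.diagonal a)).toContinuousLinearMap with hA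
  have hAi : ∀ y i, A y i = a i * y i := fun y i => by
    simp [hA, Matrix.toLpLin_apply, Matrix.mulVec_diagonal]
  set p : EuclideanSpace ℝ (Fin n) → EuclideanSpace ℝ (Fin n) := fun x =>
    WithLp.toLp 2 fun i => fderiv ℝ f x (EuclideanSpace.single i 1) with hp
  have hpi : ∀ x i, fderiv ℝ f x (EuclideanSpace.single i 1) = p x i := fun _ _ => rfl
  set D : EuclideanSpace ℝ (Fin n) → EuclideanSpace ℝ (Fin n) := fun y =>
    WithLp.toLp 2 fun i => a i * p (A y) i / b with hD
  have hDi : ∀ y i, D y i = a i * p (A y) i / b := fun _ _ => rfl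
  have hdf : ∀ x v, fderiv ℝ f x v = ∑ i, p x i * v i := by
    intro x v
    conv_lhs => rw [← (EuclideanSpace.basisFun (Fin n) ℝ).sum_repr v]
    simp [map_sum, hp, mul_comm]
  simp only [hpi] at hslope hvol
  have hDnorm : ∀ y, b ^ 2 - ∑ i, (a i) ^ 2 * (p (A y) i) ^ 2 = b ^ 2 * (1 - ‖D y‖ ^ 2) := by
    intro y
    rw [EuclideanSpace.real_norm_sq_eq, mul_sub, mul_one, Finset.mul_sum]
    congr 1
    refine Finset.sum_congr rfl fun i _ => ?_
    rw [hDi]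
    field_simp
  have hinner : ∀ y, inner ℝ (D y) y = (∑ i, p (A y) i * A y i) / b := by
    intro y
    rw [PiLp.inner_apply, Finset.sum_div]
    refine Finset.sum_congr rfl fun i _ => ?_
    rw [hDi, hAi, RCLike.inner_apply, conj_trivial]
    ring
  have hpos : ∀ y, 0 < 1 - ‖D y‖ ^ 2 := fun y =>
    pos_of_mul_pos_right (hDnorm y ▸ (hslope (A y)).1) (sq_nonneg b)
  have hlt : ∀ y, ‖D y‖ < 1 := fun y => by nlinarith [hpos y, norm_nonneg (D y)]
  set κ : EuclideanSpace ℝ (Fin n) → ℝ := fun y =>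
    (f (A y) / b - inner ℝ (D y) y) / √(1 - ‖D y‖ ^ 2) with hκ
  have hκmul : ∀ y, f (A y) / b - inner ℝ (D y) y = κ y * √(1 - ‖D y‖ ^ 2) := fun y =>
    (div_mul_cancel₀ _ (Real.sqrt_pos.2 (hpos y)).ne').symm
  have hκ1 : ∀ y, 1 ≤ κ y := by
    intro y
    rw [hκ, le_div_iff₀ (Real.sqrt_pos.2 (hpos y)), one_mul, hinner, ← sub_div, le_div_iff₀ hb,
      mul_comm]
    have h := (hslope (A y)).2
    rwa [hDnorm, Real.sqrt_mul (sq_nonneg b), Real.sqrt_sq hb.le] at h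
  have hVκ : ∀ y, V = (∏ i, a i) * b *
      (Real.pi ^ ((n : ℝ) / 2) / Real.Gamma ((n : ℝ) / 2 + 1)) *
      (∫ ζ in (1 : ℝ)..κ y, (ζ ^ 2 - 1) ^ ((n : ℝ) / 2)) := by
    intro y
    have h := hvol (A y)
    have hcut := volume_cut hn ha hb (hDi y) (hlt y) (hκ1 y)
    have hrhs : ∀ w : EuclideanSpace ℝ (Fin n) × ℝ,
        f (A y) + ∑ i, p (A y) i * (w.1 i - A y i) =
          b * (κ y * √(1 - ‖D y‖ ^ 2)) + ∑ i, p (A y) i * w.1 i := by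
      intro w
      rw [← hκmul, hinner, mul_sub, mul_div_cancel₀ _ hb.ne', mul_div_cancel₀ _ hb.ne']
      simp only [mul_sub, Finset.sum_sub_distrib]
      ring
    simp only [hrhs] at h
    rw [hcut] at h
    by_contra hne
    rcases le_or_gt ((∏ i, a i) * b *
      (Real.pi ^ ((n : ℝ) / 2) / Real.Gamma ((n : ℝ) / 2 + 1)) *
      (∫ ζ in (1 : ℝ)..κ y, (ζ ^ 2 - 1) ^ ((n : ℝ) / 2))) 0 with h0 | h0
    · rw [ENNReal.ofReal_of_nonpos h0] at h
      exact (ENNReal.ofReal_pos.2 hV).ne h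
    · exact hne ((ENNReal.ofReal_eq_ofReal_iff h0.le hV.le).1 h).symm
  have hmono := strictMonoOn_integral_sq_sub_one_rpow ((n : ℝ) / 2) (by positivity)
  have hcpos : 0 < (∏ i, a i) * b *
      (Real.pi ^ ((n : ℝ) / 2) / Real.Gamma ((n : ℝ) / 2 + 1)) := by
    have h1 : 0 < Real.Gamma ((n : ℝ) / 2 + 1) := Real.Gamma_pos_of_pos (by positivity)
    have h2 : 0 < ∏ i, a i := Finset.prod_pos fun i _ => ha i
    have := Real.pi_pos
    positivity
  have hconst : ∀ y, κ y = κ 0 := fun y =>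
    hmono.injOn (hκ1 y) (hκ1 0) (mul_left_cancel₀ hcpos.ne' ((hVκ y).symm.trans (hVκ 0)))
  have hk1 : 1 < κ 0 := by
    refine lt_of_le_of_ne (hκ1 0) fun h => ?_
    have h2 := hVκ 0
    rw [← h, intervalIntegral.integral_same, mul_zero] at h2
    exact hV.ne' h2
  refine ⟨κ 0, hk1, hVκ 0, fun x => ?_⟩
  have hDc : ContDiff ℝ 1 D := by
    rw [contDiff_euclidean]
    intro i
    have h1 : ContDiff ℝ 1 (fderiv ℝ f) := hf.fderiv_right (by norm_num)
    exact (contDiff_const.mul ((h1.comp A.contDiff).clm_apply contDiff_const)).div_const b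
  have hFD : ∀ y, HasFDerivAt (fun y => f (A y) / b) (innerSL ℝ (D y)) y := by
    intro y
    have h1 := (((hf.differentiable two_ne_zero (A y)).hasFDerivAt.comp y
      A.hasFDerivAt)).mul_const b⁻¹
    simp only [Function.comp_apply, ← div_eq_mul_inv] at h1
    refine h1.congr_fderiv (ContinuousLinearMap.ext fun v => ?_)
    rw [smul_apply, ContinuousLinearMap.comp_apply, hdf, innerSL_apply_apply, PiLp.inner_apply,
      smul_eq_mul, Finset.mul_sum]
    refine Finset.sum_congr rfl fun i _ => ?_
    rw [hDi, hAi, RCLike.inner_apply, conj_trivial]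
    ring
  set y : EuclideanSpace ℝ (Fin n) := WithLp.toLp 2 fun i => x i / a i with hy
  have hAy : A y = x := by
    ext i
    rw [hAi]
    exact mul_div_cancel₀ _ (ha i).ne'
  have hnorm : ∀ y : EuclideanSpace ℝ (Fin n), ‖y‖ ^ 2 = ∑ i, (A y i) ^ 2 / (a i) ^ 2 := by
    intro y
    rw [EuclideanSpace.real_norm_sq_eq]
    refine Finset.sum_congr rfl fun i _ => ?_
    have := (ha i).ne'
    rw [hAi]
    field_simp
  have hcone : ∀ y, ‖y‖ ≤ f (A y) / b := by
    intro y
    rw [le_div_iff₀ hb, mul_comm]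
    refine le_trans ?_ (hfin (A y)).le
    rw [← hnorm]
    gcongr
    exact Real.le_sqrt_of_sq_le (by linarith)
  have hmain := clairaut_eq_hyperboloid (lt_trans one_pos hk1) hDc hFD hlt
    (fun y => by rw [hκmul, hconst]) hcone y
  rw [hnorm, hAy, div_eq_iff hb.ne'] at hmain
  rw [hmain, mul_comm]
end

section
/- Let n ≥ 1, let p̄ ∈ ℝⁿ and (x̄, z̄) ∈ ℝⁿ × ℝ, and set d = z̄ − ⟨p̄, x̄⟩ and q = 1 − |p̄|². Suppose q > 0 and d ≥ 0, and set ζ_P = d/√q. Then the volume of the compact set S = {(x,z) ∈ ℝⁿ × ℝ : z ≥ 0, |x|² ≤ z², z ≤ z̄ + ⟨p̄, x − x̄⟩}, cut off by the hyperplane z − z̄ = ⟨p̄, x − x̄⟩ from the solid cone C = {(x,z) : z ≥ 0, |x|² ≤ z²}, equals (π^{n/2} / Γ(n/2 + 1)) · ζ_P^{n+1}/(n + 1). -/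
open MeasureTheory
open scoped RealInnerProductSpace

section LorentzReflection

variable {E : Type*} [NormedAddCommGroup E] [InnerProductSpace ℝ E]

/-- The Lorentz reflection of `E × ℝ` exchanging `(0, 1)` and `(g • p, g)`; it is an involution when
`g ^ 2 * (1 - ‖p‖ ^ 2) = 1`. -/
noncomputable def lorentzReflection (p : E) (g : ℝ) : (E × ℝ) →ₗ[ℝ] (E × ℝ) where
  toFun w := (((1 + g)⁻¹ * ((1 + g) * w.2 - g * ⟪p, w.1⟫) * g) • p - w.1, g * (w.2 - ⟪p, w.1⟫))
  map_add' v w := by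
    ext
    · simp only [Prod.fst_add, Prod.snd_add, inner_add_right]
      module
    · simp only [Prod.fst_add, Prod.snd_add, inner_add_right]
      ring
  map_smul' c w := by
    ext
    · simp only [Prod.smul_fst, Prod.smul_snd, inner_smul_right, smul_eq_mul, RingHom.id_apply]
      module
    · simp only [Prod.smul_fst, Prod.smul_snd, inner_smul_right, smul_eq_mul, RingHom.id_apply]
      ring

theorem lorentzReflection_fst (p : E) (g : ℝ) (w : E × ℝ) :
    (lorentzReflection p g w).1 =
      ((1 + g)⁻¹ * ((1 + g) * w.2 - g * ⟪p, w.1⟫) * g) • p - w.1 := rfl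

theorem lorentzReflection_snd (p : E) (g : ℝ) (w : E × ℝ) :
    (lorentzReflection p g w).2 = g * (w.2 - ⟪p, w.1⟫) := rfl

theorem lorentzReflection_involutive {p : E} {g : ℝ} (hg : 0 < g)
    (hpg : g ^ 2 * (1 - ‖p‖ ^ 2) = 1) (w : E × ℝ) :
    lorentzReflection p g (lorentzReflection p g w) = w := by
  have hg1 : 1 + g ≠ 0 := by positivity
  have hp : ‖p‖ ^ 2 = (g ^ 2 - 1) / g ^ 2 := by field_simp; linarith
  have hsnd : (lorentzReflection p g (lorentzReflection p g w)).2 = w.2 := by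
    simp only [lorentzReflection_snd, lorentzReflection_fst, inner_sub_right, inner_smul_right,
      real_inner_self_eq_norm_sq, hp]
    field_simp
    ring
  refine Prod.ext ?_ hsnd
  rw [lorentzReflection_fst, lorentzReflection_fst, lorentzReflection_snd, sub_sub_eq_add_sub,
    add_sub_right_comm, ← sub_smul]
  simp only [inner_sub_right, inner_smul_right, real_inner_self_eq_norm_sq, hp]
  convert zero_add w.1
  convert zero_smul ℝ p
  field_simp
  ring

theorem abs_det_lorentzReflection {p : E} {g : ℝ} (hg : 0 < g)
    (hpg : g ^ 2 * (1 - ‖p‖ ^ 2) = 1) : |LinearMap.det (lorentzReflection p g)| = 1 := by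
  have h : lorentzReflection p g ∘ₗ lorentzReflection p g = LinearMap.id :=
    LinearMap.ext (lorentzReflection_involutive hg hpg)
  have hdet := congrArg LinearMap.det h
  rw [LinearMap.det_comp, LinearMap.det_id] at hdet
  rcases mul_self_eq_one_iff.mp hdet with h | h <;> simp [h]

theorem lorentzReflection_form {p : E} {g : ℝ} (hg : 0 < g)
    (hpg : g ^ 2 * (1 - ‖p‖ ^ 2) = 1) (w : E × ℝ) :
    (lorentzReflection p g w).2 ^ 2 - ‖(lorentzReflection p g w).1‖ ^ 2 = w.2 ^ 2 - ‖w.1‖ ^ 2 := by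
  have hg1 : 1 + g ≠ 0 := by positivity
  have hp : ‖p‖ ^ 2 = (g ^ 2 - 1) / g ^ 2 := by field_simp; linarith
  rw [lorentzReflection_fst, lorentzReflection_snd, norm_sub_sq_real, norm_smul, mul_pow, mul_pow,
    real_inner_smul_left, hp, Real.norm_eq_abs, sq_abs]
  field_simp
  ring

theorem sub_inner_nonneg_iff {p : E} (hp : ‖p‖ < 1) {w : E × ℝ} (hw : ‖w.1‖ ^ 2 ≤ w.2 ^ 2) :
    0 ≤ w.2 - ⟪p, w.1⟫ ↔ 0 ≤ w.2 := by
  have h := abs_le.mp (abs_real_inner_le_norm p w.1)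
  have hle : ‖w.1‖ ≤ |w.2| := by simpa using sq_le_sq.mp hw
  have hmul : ‖p‖ * ‖w.1‖ ≤ ‖p‖ * |w.2| := by gcongr
  constructor
  · intro h0
    by_contra! hz
    rw [abs_of_neg hz] at hmul
    nlinarith
  · intro hz
    rw [abs_of_nonneg hz] at hmul
    nlinarith

end LorentzReflection

theorem volume_cone_le_height {n : ℕ} (hn : 1 ≤ n) {ζ : ℝ} (hζ : 0 ≤ ζ) :
    volume {w : EuclideanSpace ℝ (Fin n) × ℝ | 0 ≤ w.2 ∧ ‖w.1‖ ^ 2 ≤ w.2 ^ 2 ∧ w.2 ≤ ζ} =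
      ENNReal.ofReal (Real.pi ^ ((n : ℝ) / 2) / Real.Gamma ((n : ℝ) / 2 + 1) *
        ζ ^ (n + 1) / (n + 1)) := by
  have : Nonempty (Fin n) := ⟨⟨0, hn⟩⟩
  have hmeas : MeasurableSet
      {w : EuclideanSpace ℝ (Fin n) × ℝ | 0 ≤ w.2 ∧ ‖w.1‖ ^ 2 ≤ w.2 ^ 2 ∧ w.2 ≤ ζ} := by
    simp only [Set.ofPred_and]
    exact (measurableSet_le (by fun_prop) (by fun_prop)).inter
      ((measurableSet_le (by fun_prop) (by fun_prop)).inter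
        (measurableSet_le (by fun_prop) (by fun_prop)))
  have hc : 0 ≤ Real.pi ^ ((n : ℝ) / 2) / Real.Gamma ((n : ℝ) / 2 + 1) :=
    div_nonneg (by positivity) (Real.Gamma_pos_of_pos (by positivity)).le
  have hpi : √Real.pi ^ n = Real.pi ^ ((n : ℝ) / 2) := by
    rw [Real.sqrt_eq_rpow, ← Real.rpow_natCast, ← Real.rpow_mul Real.pi_pos.le]
    ring_nf
  have hslice (z : ℝ) : volume ((fun x : EuclideanSpace ℝ (Fin n) => (x, z)) ⁻¹'
      {w : EuclideanSpace ℝ (Fin n) × ℝ | 0 ≤ w.2 ∧ ‖w.1‖ ^ 2 ≤ w.2 ^ 2 ∧ w.2 ≤ ζ}) =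
      (Set.Icc 0 ζ).indicator (fun z => ENNReal.ofReal
        (z ^ n * (Real.pi ^ ((n : ℝ) / 2) / Real.Gamma ((n : ℝ) / 2 + 1)))) z := by
    by_cases hz : z ∈ Set.Icc 0 ζ
    · have hball : (fun x : EuclideanSpace ℝ (Fin n) => (x, z)) ⁻¹'
          {w : EuclideanSpace ℝ (Fin n) × ℝ | 0 ≤ w.2 ∧ ‖w.1‖ ^ 2 ≤ w.2 ^ 2 ∧ w.2 ≤ ζ} =
          Metric.closedBall 0 z := by
        ext x
        simp [hz.1, hz.2, sq_le_sq₀ (norm_nonneg x) hz.1]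
      rw [hball, EuclideanSpace.volume_closedBall, Set.indicator_of_mem hz, Fintype.card_fin, hpi,
        ENNReal.ofReal_mul (pow_nonneg hz.1 n), ENNReal.ofReal_pow hz.1]
    · rw [Set.indicator_of_notMem hz]
      convert measure_empty (μ := volume)
      ext x
      simp only [Set.mem_preimage, Set.mem_ofPred_eq, Set.mem_empty_iff_false, iff_false]
      exact fun h => hz ⟨h.1, h.2.2⟩
  rw [Measure.volume_eq_prod, Measure.prod_apply_symm hmeas]
  simp_rw [hslice]
  rw [lintegral_indicator measurableSet_Icc, ← ofReal_integral_eq_lintegral_ofReal,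
    integral_Icc_eq_integral_Ioc, ← intervalIntegral.integral_of_le hζ,
    intervalIntegral.integral_mul_const, integral_pow]
  · congr 1
    simp
    ring
  · exact Continuous.integrableOn_Icc (by fun_prop)
  · filter_upwards [ae_restrict_mem measurableSet_Icc] with z hz
    exact mul_nonneg (pow_nonneg hz.1 n) hc

theorem stmt_12 (n : ℕ) (hn : 1 ≤ n) (pb xb : EuclideanSpace ℝ (Fin n)) (zb : ℝ)
    (d q : ℝ) (hd : d = zb - ⟪pb, xb⟫) (hq : q = 1 - ‖pb‖ ^ 2)
    (hq0 : q > 0) (hd0 : d ≥ 0) :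
    volume {w : EuclideanSpace ℝ (Fin n) × ℝ |
        0 ≤ w.2 ∧ ‖w.1‖ ^ 2 ≤ w.2 ^ 2 ∧ w.2 ≤ zb + ⟪pb, w.1 - xb⟫} =
      ENNReal.ofReal (Real.pi ^ ((n : ℝ) / 2) / Real.Gamma ((n : ℝ) / 2 + 1) *
        (d / Real.sqrt q) ^ (n + 1) / (n + 1)) := by
  have hsq : 0 < √q := Real.sqrt_pos.mpr hq0
  have hg : 0 < (√q)⁻¹ := inv_pos.mpr hsq
  have hpg : (√q)⁻¹ ^ 2 * (1 - ‖pb‖ ^ 2) = 1 := by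
    rw [← hq, inv_pow, Real.sq_sqrt hq0.le, inv_mul_cancel₀ hq0.ne']
  have hp : ‖pb‖ < 1 := by
    have := norm_nonneg pb
    nlinarith
  have hdet := abs_det_lorentzReflection hg hpg
  have hpre : {w : EuclideanSpace ℝ (Fin n) × ℝ |
      0 ≤ w.2 ∧ ‖w.1‖ ^ 2 ≤ w.2 ^ 2 ∧ w.2 ≤ zb + ⟪pb, w.1 - xb⟫} =
      lorentzReflection pb (√q)⁻¹ ⁻¹' {w | 0 ≤ w.2 ∧ ‖w.1‖ ^ 2 ≤ w.2 ^ 2 ∧ w.2 ≤ d / √q} := by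
    ext w
    simp only [Set.mem_preimage, Set.mem_ofPred_eq]
    have hform : ‖(lorentzReflection pb (√q)⁻¹ w).1‖ ^ 2 ≤ (lorentzReflection pb (√q)⁻¹ w).2 ^ 2 ↔
        ‖w.1‖ ^ 2 ≤ w.2 ^ 2 := by
      rw [← sub_nonneg, lorentzReflection_form hg hpg, sub_nonneg]
    have hplane : w.2 ≤ zb + ⟪pb, w.1 - xb⟫ ↔ w.2 - ⟪pb, w.1⟫ ≤ d := by
      rw [inner_sub_right, hd]
      constructor <;> intro h <;> linarith
    rw [hform, lorentzReflection_snd, mul_nonneg_iff_of_pos_left hg, inv_mul_eq_div,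
      div_le_div_iff_of_pos_right hsq, hplane, and_left_comm,
      and_left_comm (a := 0 ≤ w.2 - ⟪pb, w.1⟫)]
    exact and_congr_right fun hw => and_congr_left' (sub_inner_nonneg_iff hp hw).symm
  have : (volume : Measure (EuclideanSpace ℝ (Fin n) × ℝ)).IsAddHaarMeasure :=
    Measure.prod.instIsAddHaarMeasure volume volume
  rw [hpre, Measure.addHaar_preimage_linearMap volume (by rintro h; simp [h] at hdet), abs_inv,
    hdet, inv_one, ENNReal.ofReal_one, one_mul, volume_cone_le_height hn (by positivity)]
end

section
/- Let n ≥ 1, let a₁, …, aₙ > 0 and k > 0, and set h(x,z) = z² − Σ_{i=1}^n xᵢ²/aᵢ². For every x̄ ∈ ℝⁿ, let z̄ = √(k² + Σ_{i=1}^n x̄ᵢ²/aᵢ²) and consider the hyperplane tangent at (x̄, z̄) to the upper sheet of the two-sheeted hyperboloid h(x,z) = k², namely z = (k² + Σ_{i=1}^n xᵢx̄ᵢ/aᵢ²)/z̄. The compact set it cuts off from the solid cone C = {(x,z) ∈ ℝⁿ × ℝ : z ≥ 0, h(x,z) ≥ 0} has volume independent of x̄: the (n+1)-dimensional Lebesgue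 measure of {(x,z) : z ≥ 0, Σ_{i=1}^n xᵢ²/aᵢ² ≤ z², z ≤ (k² + Σ_{i=1}^n xᵢx̄ᵢ/aᵢ²)/z̄} equals a₁⋯aₙ · (π^{n/2} / Γ(n/2 + 1)) · k^{n+1}/(n + 1). -/
open MeasureTheory

/-- The Lorentz rotation by a half turn about the axis through `(y, z + k)`. When
`z ^ 2 = k ^ 2 + ‖y‖ ^ 2` it exchanges `(y, z)` and `(0, k)`. -/
noncomputable def lorentzHalfTurn {F : Type*} [NormedAddCommGroup F] [InnerProductSpace ℝ F]
    (k z : ℝ) (y : F) : F × ℝ →ₗ[ℝ] F × ℝ where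
  toFun w := (((w.2 * (z + k) - inner ℝ w.1 y) / (k * (z + k))) • y - w.1,
    (w.2 * z - inner ℝ w.1 y) / k)
  map_add' v w := by
    ext1
    · simp only [Prod.fst_add, Prod.snd_add, inner_add_left]
      module
    · simp only [Prod.fst_add, Prod.snd_add, inner_add_left]
      ring
  map_smul' c w := by
    ext1
    · simp only [Prod.smul_fst, Prod.smul_snd, real_inner_smul_left, smul_eq_mul,
        RingHom.id_apply]
      module
    · simp only [Prod.smul_fst, Prod.smul_snd, real_inner_smul_left, smul_eq_mul,
        RingHom.id_apply]
      ring

lemma norm_fst_le_snd_iff {F : Type*} [SeminormedAddCommGroup F] {w : F × ℝ} :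
    ‖w.1‖ ≤ w.2 ↔ 0 ≤ w.2 ∧ 0 ≤ w.2 ^ 2 - ‖w.1‖ ^ 2 := by
  rw [sub_nonneg]
  refine ⟨fun h => ⟨(norm_nonneg _).trans h, by gcongr⟩, fun h => ?_⟩
  exact (sq_le_sq₀ (norm_nonneg _) h.1).1 h.2

section LorentzHalfTurn

variable {F : Type*} [NormedAddCommGroup F] [InnerProductSpace ℝ F]

lemma lorentzHalfTurn_apply (k z : ℝ) (y : F) (w : F × ℝ) :
    lorentzHalfTurn k z y w =
      (((w.2 * (z + k) - inner ℝ w.1 y) / (k * (z + k))) • y - w.1,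
        (w.2 * z - inner ℝ w.1 y) / k) := rfl

variable {k z : ℝ} {y : F}

lemma lorentzHalfTurn_involutive (hk : 0 < k) (hz : 0 < z) (h : z ^ 2 = k ^ 2 + ‖y‖ ^ 2)
    (w : F × ℝ) : lorentzHalfTurn k z y (lorentzHalfTurn k z y w) = w := by
  have hzk : z + k ≠ 0 := by positivity
  have hy : ‖y‖ ^ 2 = z ^ 2 - k ^ 2 := by linarith
  ext1
  · simp only [lorentzHalfTurn_apply, inner_sub_left, real_inner_smul_left,
      real_inner_self_eq_norm_sq, hy]
    rw [sub_sub_eq_add_sub, add_sub_right_comm, ← sub_smul, add_eq_right]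
    convert zero_smul ℝ y using 2
    field_simp
    ring
  · simp only [lorentzHalfTurn_apply, inner_sub_left, real_inner_smul_left,
      real_inner_self_eq_norm_sq, hy]
    field_simp
    ring

lemma sq_sub_norm_sq_lorentzHalfTurn (hk : 0 < k) (hz : 0 < z) (h : z ^ 2 = k ^ 2 + ‖y‖ ^ 2)
    (w : F × ℝ) :
    (lorentzHalfTurn k z y w).2 ^ 2 - ‖(lorentzHalfTurn k z y w).1‖ ^ 2 =
      w.2 ^ 2 - ‖w.1‖ ^ 2 := by
  have hzk : z + k ≠ 0 := by positivity
  have hy : ‖y‖ ^ 2 = z ^ 2 - k ^ 2 := by linarith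
  simp only [lorentzHalfTurn_apply, norm_sub_sq_real, norm_smul, mul_pow, Real.norm_eq_abs,
    sq_abs, real_inner_smul_left, hy, real_inner_comm w.1 y]
  field_simp
  ring

lemma lorentzHalfTurn_mem_cone (hk : 0 < k) (hz : 0 < z) (h : z ^ 2 = k ^ 2 + ‖y‖ ^ 2)
    {w : F × ℝ} (hw : ‖w.1‖ ≤ w.2) :
    ‖(lorentzHalfTurn k z y w).1‖ ≤ (lorentzHalfTurn k z y w).2 := by
  rw [norm_fst_le_snd_iff, sq_sub_norm_sq_lorentzHalfTurn hk hz h]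
  refine ⟨div_nonneg ?_ hk.le, (norm_fst_le_snd_iff.1 hw).2⟩
  have hyz : ‖y‖ ≤ z := (sq_le_sq₀ (norm_nonneg _) hz.le).1 (by nlinarith)
  have := real_inner_le_norm w.1 y
  have : ‖w.1‖ * ‖y‖ ≤ w.2 * z := by
    have := (norm_nonneg _).trans hw
    gcongr
  linarith

/-- The caps cut off from the light cone by the tangent hyperplanes of the hyperboloid
`t ^ 2 - ‖x‖ ^ 2 = k ^ 2` all have the same volume. -/
lemma volume_cone_inter_tangent [MeasurableSpace F] [BorelSpace F] [FiniteDimensional ℝ F]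
    (hk : 0 < k) (hz : 0 < z) (h : z ^ 2 = k ^ 2 + ‖y‖ ^ 2) :
    volume {w : F × ℝ | ‖w.1‖ ≤ w.2 ∧ w.2 * z - inner ℝ w.1 y ≤ k ^ 2} =
      volume {w : F × ℝ | ‖w.1‖ ≤ w.2 ∧ w.2 ≤ k} := by
  set L := lorentzHalfTurn k z y
  have hL : L ∘ₗ L = LinearMap.id := LinearMap.ext (lorentzHalfTurn_involutive hk hz h)
  have hdet : L.det * L.det = 1 := by rw [← LinearMap.det_comp, hL, LinearMap.det_id]
  have habs : |L.det| = 1 := by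
    rcases mul_self_eq_one_iff.1 hdet with h | h <;> simp [h]
  have hpre : {w : F × ℝ | ‖w.1‖ ≤ w.2 ∧ w.2 * z - inner ℝ w.1 y ≤ k ^ 2} =
      L ⁻¹' {w : F × ℝ | ‖w.1‖ ≤ w.2 ∧ w.2 ≤ k} := by
    ext w
    refine and_congr ⟨lorentzHalfTurn_mem_cone hk hz h, fun hw => ?_⟩ ?_
    · simpa only [L, lorentzHalfTurn_involutive hk hz h] using
        lorentzHalfTurn_mem_cone hk hz h hw
    · rw [show (L w).2 = (w.2 * z - inner ℝ w.1 y) / k from rfl, div_le_iff₀ hk, sq]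
  have hvol : (volume : Measure (F × ℝ)).IsAddHaarMeasure :=
    inferInstanceAs ((volume : Measure F).prod (volume : Measure ℝ)).IsAddHaarMeasure
  rw [hpre, Measure.addHaar_preimage_linearMap _ (left_ne_zero_of_mul_eq_one hdet), abs_inv,
    habs]
  simp

end LorentzHalfTurn

lemma volume_cone_height_le (n : ℕ) (hn : 1 ≤ n) {k : ℝ} (hk : 0 < k) :
    volume {w : EuclideanSpace ℝ (Fin n) × ℝ | ‖w.1‖ ≤ w.2 ∧ w.2 ≤ k} =
      ENNReal.ofReal ((Real.pi ^ ((n : ℝ) / 2) / Real.Gamma ((n : ℝ) / 2 + 1)) *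
        k ^ (n + 1) / (n + 1)) := by
  have : Nonempty (Fin n) := ⟨⟨0, hn⟩⟩
  set c := Real.pi ^ ((n : ℝ) / 2) / Real.Gamma ((n : ℝ) / 2 + 1)
  have hc0 : 0 ≤ c := by positivity
  have hsqrt : √Real.pi ^ n = Real.pi ^ ((n : ℝ) / 2) := by
    rw [Real.sqrt_eq_rpow, ← Real.rpow_natCast, ← Real.rpow_mul Real.pi_pos.le]
    ring_nf
  have hmeas : MeasurableSet {w : EuclideanSpace ℝ (Fin n) × ℝ | ‖w.1‖ ≤ w.2 ∧ w.2 ≤ k} :=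
    (measurableSet_le measurable_fst.norm measurable_snd).inter
      (measurableSet_le measurable_snd measurable_const)
  have hslice (t : ℝ) : volume ((fun x : EuclideanSpace ℝ (Fin n) => (x, t)) ⁻¹'
      {w | ‖w.1‖ ≤ w.2 ∧ w.2 ≤ k}) =
      (Set.Icc 0 k).indicator (fun t => ENNReal.ofReal (t ^ n * c)) t := by
    by_cases ht : t ∈ Set.Icc 0 k
    · have : (fun x : EuclideanSpace ℝ (Fin n) => (x, t)) ⁻¹' {w | ‖w.1‖ ≤ w.2 ∧ w.2 ≤ k} =
          Metric.closedBall 0 t := by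
        ext x
        simp [ht.2]
      rw [this, Set.indicator_of_mem ht, EuclideanSpace.volume_closedBall,
        ENNReal.ofReal_mul (pow_nonneg ht.1 n), ENNReal.ofReal_pow ht.1, Fintype.card_fin,
        hsqrt]
    · rw [Set.indicator_of_notMem ht]
      convert measure_empty (μ := volume)
      exact Set.eq_empty_of_forall_notMem fun x hx => ht ⟨(norm_nonneg x).trans hx.1, hx.2⟩
  rw [Measure.volume_eq_prod, Measure.prod_apply_symm hmeas]
  simp_rw [hslice]
  rw [lintegral_indicator measurableSet_Icc, ← ofReal_integral_eq_lintegral_ofReal,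
    integral_Icc_eq_integral_Ioc, ← intervalIntegral.integral_of_le hk.le,
    intervalIntegral.integral_mul_const, integral_pow]
  · congr 1
    simp
    ring
  · exact Continuous.integrableOn_Icc (by fun_prop)
  · exact (ae_restrict_iff' measurableSet_Icc).2
      (.of_forall fun t ht => mul_nonneg (pow_nonneg ht.1 n) hc0)

theorem stmt_13 (n : ℕ) (hn : 1 ≤ n) (a : Fin n → ℝ) (ha : ∀ i, a i > 0)
    (k : ℝ) (hk : k > 0) (xb : EuclideanSpace ℝ (Fin n)) (zb : ℝ)
    (hzb : zb = Real.sqrt (k ^ 2 + ∑ i, (xb i) ^ 2 / (a i) ^ 2)) :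
    volume {w : EuclideanSpace ℝ (Fin n) × ℝ |
        0 ≤ w.2 ∧ (∑ i, (w.1 i) ^ 2 / (a i) ^ 2) ≤ w.2 ^ 2 ∧
        w.2 ≤ (k ^ 2 + ∑ i, w.1 i * xb i / (a i) ^ 2) / zb} =
      ENNReal.ofReal ((∏ i, a i) *
        (Real.pi ^ ((n : ℝ) / 2) / Real.Gamma ((n : ℝ) / 2 + 1)) *
        k ^ (n + 1) / (n + 1)) := by
  set D : EuclideanSpace ℝ (Fin n) →ₗ[ℝ] EuclideanSpace ℝ (Fin n) :=
    (Matrix.diagonal fun i => (a i)⁻¹).toLpLin 2 2 with hD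
  have hDapp (x : EuclideanSpace ℝ (Fin n)) (i : Fin n) : D x i = x i / a i := by
    simp [hD, Matrix.toLpLin_apply, Matrix.mulVec_diagonal, div_eq_inv_mul]
  have hDnorm (x : EuclideanSpace ℝ (Fin n)) : ‖D x‖ ^ 2 = ∑ i, x i ^ 2 / a i ^ 2 := by
    simp [EuclideanSpace.norm_sq_eq, hDapp, div_pow]
  have hDinner (x : EuclideanSpace ℝ (Fin n)) :
      inner ℝ (D x) (D xb) = ∑ i, x i * xb i / a i ^ 2 := by
    rw [PiLp.inner_apply]
    refine Finset.sum_congr rfl fun i _ => ?_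
    simp only [hDapp, RCLike.inner_apply, conj_trivial]
    ring
  have hpos : 0 < k ^ 2 + ∑ i, xb i ^ 2 / a i ^ 2 := by positivity
  have hzb0 : 0 < zb := hzb ▸ Real.sqrt_pos.2 hpos
  have hzb2 : zb ^ 2 = k ^ 2 + ‖D xb‖ ^ 2 := by rw [hzb, Real.sq_sqrt hpos.le, hDnorm]
  have hprod : 0 < ∏ i, a i := Finset.prod_pos fun i _ => ha i
  have hdet : (D.prodMap (LinearMap.id : ℝ →ₗ[ℝ] ℝ)).det = (∏ i, a i)⁻¹ := by
    rw [LinearMap.det_prodMap, LinearMap.det_id, hD, LinearMap.det_toLpLin, Matrix.det_diagonal,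
      Finset.prod_inv_distrib, mul_one]
  have hpre : {w : EuclideanSpace ℝ (Fin n) × ℝ |
        0 ≤ w.2 ∧ (∑ i, (w.1 i) ^ 2 / (a i) ^ 2) ≤ w.2 ^ 2 ∧
        w.2 ≤ (k ^ 2 + ∑ i, w.1 i * xb i / (a i) ^ 2) / zb} =
      D.prodMap (LinearMap.id : ℝ →ₗ[ℝ] ℝ) ⁻¹'
        {w | ‖w.1‖ ≤ w.2 ∧ w.2 * zb - inner ℝ w.1 (D xb) ≤ k ^ 2} := by
    ext w
    simp only [Set.mem_ofPred_eq, Set.mem_preimage, LinearMap.prodMap_apply, LinearMap.id_apply,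
      norm_fst_le_snd_iff (w := (D w.1, w.2)), hDnorm, hDinner, le_div_iff₀ hzb0, sub_nonneg,
      sub_le_iff_le_add, and_assoc]
  have hvol : (volume : Measure (EuclideanSpace ℝ (Fin n) × ℝ)).IsAddHaarMeasure :=
    inferInstanceAs ((volume : Measure (EuclideanSpace ℝ (Fin n))).prod
      (volume : Measure ℝ)).IsAddHaarMeasure
  rw [hpre, Measure.addHaar_preimage_linearMap _ (hdet ▸ (inv_pos.2 hprod).ne'), hdet, inv_inv,
    abs_of_pos hprod, volume_cone_inter_tangent hk hzb0 hzb2, volume_cone_height_le n hn hk,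
    ← ENNReal.ofReal_mul hprod.le, mul_div_assoc, mul_div_assoc, mul_assoc]
end
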